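/- arXiv:2202.00318 — 7 statements merged into one kernel-verified Lean document; each statement's English description precedes it below -/
import Mathlib

section
/- Let G be a connected, locally finite simple graph on a countable vertex set V with shortest-path distance dist, and suppose there exist constants C > 0 and a ≥ 0 such that #{w ∈ V : dist(v,w) = d} ≤ C·d^a for every vertex v and every integer d ≥ 1. Let s ∈ ℝ with s > a + 1. Then for every f ∈ ℓ²(V): (i) for each v ∈ V the series ∑_{w ≠ v} (f(v) - f(w))·dist(v,w)^{-s} converges absolutely; (ii) the function g : V → ℝ defined by g(v) = ∑_{w ≠ v} (f(v) - f(w))·dist(v,w)^{-s} belongs to ℓ²(V); and (iii) ‖g‖_{ℓ²} ≤ 2·C·ζ(s - a)·‖f‖_{ℓ²}, where ζ is the Riemann zeta function. In particular the Mellin-transformed d-path Laplacian is a bounded operator on ℓ²(V). -/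
open Filter

/-- Real Riemann zeta function `ζ(x) = ∑_{k=1}^∞ k^{-x}`. -/
noncomputable def zetaReal (x : ℝ) : ℝ := ∑' k : ℕ+, (k : ℝ) ^ (-x)

theorem mpl_row {V : Type*} (G : SimpleGraph V) (C a : ℝ) (hC : 0 < C)
    (hsphere : ∀ (v : V) (d : ℕ), 1 ≤ d →
      {w : V | G.dist v w = d}.Finite ∧
      (Nat.card {w : V | G.dist v w = d} : ℝ) ≤ C * (d : ℝ) ^ a)
    (s : ℝ) (hs : a + 1 < s) (hs0 : 0 < s) (v : V) (T : Finset V) :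
    ∑ w ∈ T, (G.dist v w : ℝ) ^ (-s) ≤ C * zetaReal (s - a) := by
  classical
  have hz : zetaReal (s - a) = ∑' n : ℕ, ((n + 1 : ℕ) : ℝ) ^ (-(s - a)) := by
    unfold zetaReal
    exact tsum_pnat_eq_tsum_succ (f := fun n : ℕ => (n : ℝ) ^ (-(s - a)))
  have h0 : Summable (fun n : ℕ => (n : ℝ) ^ (-(s - a))) := by
    rw [Real.summable_nat_rpow]; linarith
  have hz' : zetaReal (s - a) = ∑' n : ℕ, (n : ℝ) ^ (-(s - a)) := by
    rw [hz, h0.tsum_eq_zero_add, Nat.cast_zero, Real.zero_rpow (by linarith), zero_add]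
  rw [← Finset.sum_fiberwise_of_maps_to (t := T.image (G.dist v)) (g := G.dist v)
    (fun w hw => Finset.mem_image_of_mem _ hw), hz', ← tsum_mul_left]
  refine le_trans (Finset.sum_le_sum (g := fun d : ℕ => C * (d : ℝ) ^ (-(s - a))) ?_)
    ((h0.mul_left C).sum_le_tsum _ (fun d _ => by positivity))
  intro d _
  have e : ∑ w ∈ T with G.dist v w = d, (G.dist v w : ℝ) ^ (-s)
      = ((T.filter (fun w => G.dist v w = d)).card : ℝ) * (d : ℝ) ^ (-s) := by
    rw [← nsmul_eq_mul, ← Finset.sum_const]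
    refine Finset.sum_congr rfl fun w hw => ?_
    rw [(Finset.mem_filter.1 hw).2]
  rw [e]
  rcases Nat.eq_zero_or_pos d with rfl | hd
  · rw [Nat.cast_zero, Real.zero_rpow (by linarith), Real.zero_rpow (by linarith)]; simp
  · obtain ⟨hfin, hcard⟩ := hsphere v d hd
    have h1 : ((T.filter (fun w => G.dist v w = d)).card : ℝ) ≤ C * (d : ℝ) ^ a := by
      refine le_trans ?_ hcard
      rw [Nat.card_coe_set_eq, ← Set.ncard_coe_finset]
      refine Nat.cast_le.2 (Set.ncard_le_ncard ?_ hfin)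
      intro w hw
      exact (Finset.mem_filter.1 (Finset.mem_coe.1 hw)).2
    have hd' : (0 : ℝ) < d := by exact_mod_cast hd
    have h2 : (d : ℝ) ^ (-(s - a)) = (d : ℝ) ^ a * (d : ℝ) ^ (-s) := by
      rw [← Real.rpow_add hd']; congr 1; ring
    rw [h2, ← mul_assoc]
    gcongr

theorem mpl_core {V : Type*} (k : V → V → ℝ) (hk : ∀ v w, 0 ≤ k v w)
    (hsym : ∀ v w, k v w = k w v) (M : ℝ) (hM : 0 < M)
    (hrow : ∀ v (T : Finset V), ∑ w ∈ T, k v w ≤ M)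
    (f : V → ℝ) (hf : Summable (fun v => (f v) ^ 2)) :
    (∀ v, Summable (fun w => |(f v - f w) * k v w|)) ∧
    (∀ A : Finset V, ∑ v ∈ A, (∑' w, (f v - f w) * k v w) ^ 2
      ≤ (2 * M) ^ 2 * ∑' v, f v ^ 2) := by
  have hks : ∀ v, Summable (k v) := fun v => summable_of_sum_le (hk v) (hrow v)
  have hkM : ∀ v, ∑' w, k v w ≤ M := fun v => (hks v).tsum_le_of_sum_le (hrow v)
  have hT : ∀ v, Summable (fun w => k v w * f w ^ 2) := fun v => by
    refine Summable.of_nonneg_of_le (fun w => mul_nonneg (hk v w) (sq_nonneg _))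
      (fun w => mul_le_mul_of_nonneg_left (hf.le_tsum w (fun _ _ => sq_nonneg _)) (hk v w))
      ((hks v).mul_right _)
  have hB : ∀ v, Summable (fun w => 2 * f v ^ 2 * k v w + 2 * (k v w * f w ^ 2)) := fun v =>
    ((hks v).mul_left _).add ((hT v).mul_left 2)
  have hS : ∀ v, Summable (fun w => k v w * (f v - f w) ^ 2) := fun v => by
    refine Summable.of_nonneg_of_le (fun w => mul_nonneg (hk v w) (sq_nonneg _)) (fun w => ?_) (hB v)
    nlinarith [mul_nonneg (hk v w) (sq_nonneg (f v + f w))]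
  have hA : ∀ v, Summable (fun w => |(f v - f w) * k v w|) := fun v => by
    refine Summable.of_nonneg_of_le (fun w => abs_nonneg _) (fun w => ?_) ((hks v).add (hS v))
    rw [abs_mul, abs_of_nonneg (hk v w), ← sq_abs (f v - f w)]
    nlinarith [mul_nonneg (hk v w) (sq_nonneg (|f v - f w| - 1)),
      mul_nonneg (hk v w) (sq_nonneg (|f v - f w|)), hk v w]
  refine ⟨hA, fun A => ?_⟩
  have hg : ∀ v, Summable (fun w => (f v - f w) * k v w) := fun v => (hA v).of_abs
  have hSle : ∀ v, ∑' w, k v w * (f v - f w) ^ 2 ≤ 2 * f v ^ 2 * M + 2 * ∑' w, k v w * f w ^ 2 := by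
    intro v
    calc _ ≤ ∑' w, (2 * f v ^ 2 * k v w + 2 * (k v w * f w ^ 2)) :=
          (hS v).tsum_le_tsum (fun w => by
            nlinarith [mul_nonneg (hk v w) (sq_nonneg (f v + f w))]) (hB v)
      _ = 2 * f v ^ 2 * ∑' w, k v w + 2 * ∑' w, k v w * f w ^ 2 := by
          rw [((hks v).mul_left _).tsum_add ((hT v).mul_left 2), tsum_mul_left, tsum_mul_left]
      _ ≤ _ := by have := hkM v; gcongr
  have hCS : ∀ v, (∑' w, (f v - f w) * k v w) ^ 2 ≤ M * ∑' w, k v w * (f v - f w) ^ 2 := by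
    intro v
    set g := ∑' w, (f v - f w) * k v w with hgdef
    set S := ∑' w, k v w * (f v - f w) ^ 2 with hSdef
    have h : 0 ≤ ∑' w, k v w * ((f v - f w) - g / M) ^ 2 :=
      tsum_nonneg fun w => mul_nonneg (hk v w) (sq_nonneg _)
    have e : ∑' w, k v w * ((f v - f w) - g / M) ^ 2
        = S - 2 * (g / M) * g + (g / M) ^ 2 * ∑' w, k v w := by
      rw [hgdef, hSdef, ← tsum_mul_left, ← tsum_mul_left, ← hgdef,
        ← (hS v).tsum_sub ((hg v).mul_left _),
        ← ((hS v).sub ((hg v).mul_left _)).tsum_add ((hks v).mul_left _)]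
      exact tsum_congr fun w => by ring
    rw [e] at h
    have h2 : (g / M) ^ 2 * ∑' w, k v w ≤ (g / M) ^ 2 * M := by
      have := hkM v; gcongr
    have h3 : 0 ≤ S - g ^ 2 / M := by
      have : S - g ^ 2 / M = S - 2 * (g / M) * g + (g / M) ^ 2 * M := by field_simp; ring
      linarith
    have h4 : g ^ 2 / M ≤ S := by linarith
    rw [div_le_iff₀ hM] at h4
    linarith
  have hTA : ∑ v ∈ A, ∑' w, k v w * f w ^ 2 ≤ M * ∑' v, f v ^ 2 := by
    rw [← Summable.tsum_finsetSum (fun v _ => hT v), ← tsum_mul_left]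
    refine (summable_sum (fun v _ => hT v)).tsum_le_tsum (fun w => ?_) (hf.mul_left M)
    rw [← Finset.sum_mul]
    refine mul_le_mul_of_nonneg_right ?_ (sq_nonneg _)
    rw [Finset.sum_congr rfl (fun v _ => hsym v w)]
    exact hrow w A
  have hFA : ∑ v ∈ A, f v ^ 2 ≤ ∑' v, f v ^ 2 := hf.sum_le_tsum A (fun _ _ => sq_nonneg _)
  calc _ ≤ ∑ v ∈ A, M * (2 * f v ^ 2 * M + 2 * ∑' w, k v w * f w ^ 2) :=
        Finset.sum_le_sum fun v _ => (hCS v).trans (mul_le_mul_of_nonneg_left (hSle v) hM.le)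
    _ = M * (2 * M * ∑ v ∈ A, f v ^ 2 + 2 * ∑ v ∈ A, ∑' w, k v w * f w ^ 2) := by
        rw [← Finset.mul_sum, Finset.sum_add_distrib, ← Finset.mul_sum,
          Finset.mul_sum A (fun v => f v ^ 2)]
        congr 2
        exact Finset.sum_congr rfl fun v _ => by ring
    _ ≤ M * (2 * M * ∑' v, f v ^ 2 + 2 * (M * ∑' v, f v ^ 2)) := by gcongr
    _ = _ := by ring

/-- boundedness of the Mellin-transformed d-path Laplacian on `ℓ²(V)`
for a connected locally finite graph with sphere growth `#{w : dist v w = d} ≤ C d^a`,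
whenever `s > a + 1`. -/
theorem mellinPathLaplacian_bounded_l2
    {V : Type*} [Countable V] (G : SimpleGraph V) (hG : G.Connected)
    (hlf : G.LocallyFinite) (C a : ℝ) (hC : 0 < C) (ha : 0 ≤ a)
    (hsphere : ∀ (v : V) (d : ℕ), 1 ≤ d →
      {w : V | G.dist v w = d}.Finite ∧
      (Nat.card {w : V | G.dist v w = d} : ℝ) ≤ C * (d : ℝ) ^ a)
    (s : ℝ) (hs : a + 1 < s)
    (f : V → ℝ) (hf : Summable (fun v => (f v) ^ 2)) :
    -- (i) absolute convergence of the defining series at every vertex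
    (∀ v : V, Summable (fun w : {w : V // w ≠ v} =>
        |(f v - f (w : V)) * (G.dist v (w : V) : ℝ) ^ (-s)|)) ∧
    -- (ii) the image function `g` is again square-summable
    Summable (fun v : V =>
      (∑' w : {w : V // w ≠ v}, (f v - f (w : V)) * (G.dist v (w : V) : ℝ) ^ (-s)) ^ 2) ∧
    -- (iii) the ℓ² norm bound `‖g‖ ≤ 2 C ζ(s-a) ‖f‖`
    Real.sqrt (∑' v : V,
        (∑' w : {w : V // w ≠ v}, (f v - f (w : V)) * (G.dist v (w : V) : ℝ) ^ (-s)) ^ 2) ≤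
      2 * C * zetaReal (s - a) * Real.sqrt (∑' v : V, (f v) ^ 2) := by
  have hzpos : 0 < zetaReal (s - a) := by
    have h0 : Summable (fun k : ℕ+ => (k : ℝ) ^ (-(s - a))) :=
      (Real.summable_nat_rpow.2 (by linarith : -(s - a) < -1)).comp_injective PNat.coe_injective
    exact h0.tsum_pos (fun k => by positivity) 1 (by simp)
  have hM : 0 < C * zetaReal (s - a) := mul_pos hC hzpos
  obtain ⟨h1, h2⟩ := mpl_core (fun v w => (G.dist v w : ℝ) ^ (-s)) (fun v w => by positivity)
    (fun v w => by simp only [G.dist_comm]) _ hM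
    (fun v T => mpl_row G C a hC hsphere s hs (by linarith) v T) f hf
  have e : ∀ v : V, (∑' w : {w : V // w ≠ v}, (f v - f (w : V)) * (G.dist v (w : V) : ℝ) ^ (-s))
      = ∑' w, (f v - f w) * (G.dist v w : ℝ) ^ (-s) := fun v => by
    refine tsum_subtype_eq_of_support_subset (s := {w : V | w ≠ v})
      (f := fun w => (f v - f w) * (G.dist v w : ℝ) ^ (-s)) ?_
    intro w hw h
    subst h
    simp at hw
  simp only [e]
  have h3 := summable_of_sum_le (fun v => sq_nonneg _) h2
  refine ⟨fun v => (h1 v).comp_injective Subtype.val_injective, h3, ?_⟩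
  have h4 := h3.tsum_le_of_sum_le h2
  refine (Real.sqrt_le_sqrt h4).trans (le_of_eq ?_)
  rw [Real.sqrt_mul (sq_nonneg _), Real.sqrt_sq (by positivity), mul_assoc 2 C]
end

section
/- Let 0 < α < 1, λ ≥ 0 and y₀ ∈ ℝ, and define y(t) = y₀ · E_α(-λ t^α) for t ≥ 0. Then y(0) = y₀, y is differentiable on (0,∞), and for every t > 0 the Caputo fractional derivative of y satisfies D^α y(t) = -λ · y(t). -/
/-- The Mittag-Leffler function `E_α(x) = ∑_{j=0}^∞ x^j / Γ(α j + 1)`. -/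
noncomputable def mittagLeffler (α x : ℝ) : ℝ :=
  ∑' j : ℕ, x ^ j / Real.Gamma (α * j + 1)

/-- The Caputo fractional derivative
`D^α y(t) = (1/Γ(1-α)) ∫_0^t y'(τ) (t-τ)^{-α} dτ`. -/
noncomputable def caputoDeriv (α : ℝ) (y : ℝ → ℝ) (t : ℝ) : ℝ :=
  (1 / Real.Gamma (1 - α)) * ∫ τ in (0:ℝ)..t, deriv y τ * (t - τ) ^ (-α)

open MeasureTheory Set in
lemma ml_gamma_lower {s R : ℝ} (hs : 0 ≤ s) (hR : 0 < R) :
    R ^ s * Real.exp (-R) ≤ Real.Gamma (s + 1) := by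
  rw [Real.Gamma_eq_integral (by linarith), ← integral_exp_neg_Ioi, ← integral_const_mul]
  have hint := Real.GammaIntegral_convergent (s := s + 1) (by linarith)
  have hsub : Ioi R ⊆ Ioi 0 := Ioi_subset_Ioi hR.le
  calc _ ≤ ∫ x in Ioi R, Real.exp (-x) * x ^ (s + 1 - 1) := by
        refine setIntegral_mono_on ?_ (hint.mono_set hsub) measurableSet_Ioi ?_
        · exact (integrableOn_exp_neg_Ioi R).const_mul _
        · intro x hx
          rw [mul_comm, add_sub_cancel_right]
          have : R ^ s ≤ x ^ s := Real.rpow_le_rpow hR.le (le_of_lt hx) hs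
          gcongr
    _ ≤ _ := by
        refine setIntegral_mono_set hint ?_ hsub.eventuallyLE
        filter_upwards [ae_restrict_mem measurableSet_Ioi] with x hx
        have : (0:ℝ) < x := hx
        simp only [Pi.zero_apply]
        positivity

lemma ml_gpos {α : ℝ} (hα : 0 < α) (j : ℕ) : 0 < Real.Gamma (α * j + 1) :=
  Real.Gamma_pos_of_pos (by positivity)

lemma ml_summable_abs {α : ℝ} (hα : 0 < α) {x : ℝ} (hx : 0 ≤ x) :
    Summable fun j : ℕ => x ^ j / Real.Gamma (α * j + 1) := by
  set B : ℝ := 2 * x + 1 with hB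
  have hBp : 0 < B := by positivity
  set R : ℝ := B ^ (1 / α) with hR
  have hRp : 0 < R := Real.rpow_pos_of_pos hBp _
  have hRB : R ^ α = B := by
    rw [hR, ← Real.rpow_mul hBp.le, one_div_mul_cancel hα.ne', Real.rpow_one]
  have hg : Summable fun j : ℕ => Real.exp R * (x / B) ^ j := by
    refine (summable_geometric_of_lt_one (by positivity) ?_).mul_left _
    rw [div_lt_one hBp]; linarith
  refine Summable.of_nonneg_of_le (fun j => ?_) (fun j => ?_) hg
  · have := ml_gpos hα j
    positivity
  · have h := ml_gamma_lower (s := α * j) (R := R) (by positivity) hRp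
    rw [Real.rpow_mul hRp.le, hRB, Real.rpow_natCast] at h
    rw [div_le_iff₀ (ml_gpos hα j)]
    calc x ^ j = Real.exp R * (x / B) ^ j * (B ^ j * Real.exp (-R)) := by
          rw [Real.exp_neg, div_pow]; field_simp
      _ ≤ _ := by gcongr

lemma ml_summable {α : ℝ} (hα : 0 < α) (x : ℝ) :
    Summable fun j : ℕ => x ^ j / Real.Gamma (α * j + 1) := by
  refine Summable.of_norm ?_
  convert ml_summable_abs hα (abs_nonneg x) using 2 with j
  rw [norm_div, norm_pow, Real.norm_eq_abs, Real.norm_of_nonneg (ml_gpos hα j).le]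

lemma ml_summable_deriv {α : ℝ} (hα : 0 < α) {x : ℝ} (hx : 0 ≤ x) :
    Summable fun j : ℕ => j * x ^ (j - 1) / Real.Gamma (α * j + 1) := by
  have h := (ml_summable_abs hα (x := 2 * (x + 1)) (by positivity))
  refine Summable.of_nonneg_of_le (fun j => ?_) (fun j => ?_) h
  · have := ml_gpos hα j
    positivity
  · have := ml_gpos hα j
    rw [mul_pow]
    have h1 : (j : ℝ) ≤ 2 ^ j := by exact_mod_cast Nat.lt_two_pow_self.le
    have h2 : x ^ (j - 1) ≤ (x + 1) ^ j :=
      (pow_le_pow_left₀ hx (by linarith) _).trans (pow_le_pow_right₀ (by linarith) (by omega))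
    gcongr

lemma ml_hasDerivAt {α : ℝ} (hα : 0 < α) (x : ℝ) :
    HasDerivAt (mittagLeffler α) (∑' j : ℕ, j * x ^ (j - 1) / Real.Gamma (α * j + 1)) x := by
  have hpos : 0 < |x| + 1 := by positivity
  refine hasDerivAt_tsum_of_isPreconnected (t := Metric.ball (0:ℝ) (|x| + 1)) (y₀ := 0)
    (g := fun (j : ℕ) z => z ^ j / Real.Gamma (α * j + 1))
    (g' := fun (j : ℕ) z => j * z ^ (j - 1) / Real.Gamma (α * j + 1))
    (ml_summable_deriv hα hpos.le) Metric.isOpen_ball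
    (convex_ball _ _).isPreconnected (fun n y _ => ?_) (fun n y hy => ?_) (by simpa using hpos)
    (ml_summable hα 0) (by simp)
  · exact (hasDerivAt_pow n y).div_const _
  · have := ml_gpos hα n
    have hy' : |y| ≤ |x| + 1 := by simpa using (Metric.mem_ball.1 hy).le
    rw [norm_div, norm_mul, norm_pow, Real.norm_of_nonneg this.le, Real.norm_natCast,
      Real.norm_eq_abs]
    gcongr

/-- derivative of the solution -/
lemma ml_sol_hasDerivAt {α : ℝ} (hα : 0 < α) (lam y₀ : ℝ) {t : ℝ} (ht : 0 < t) :
    HasDerivAt (fun t : ℝ => y₀ * mittagLeffler α (-lam * t ^ α))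
      (∑' k : ℕ, y₀ * (-lam) ^ (k + 1) / Real.Gamma (α * (k + 1)) * t ^ (α * (k + 1) - 1)) t := by
  have h1 : HasDerivAt (fun t : ℝ => -lam * t ^ α) (-lam * (α * t ^ (α - 1))) t :=
    (Real.hasDerivAt_rpow_const (Or.inl ht.ne')).const_mul _
  have h2 := ((ml_hasDerivAt hα (-lam * t ^ α)).comp t h1).const_mul y₀
  refine h2.congr_deriv ?_
  symm
  have hs : Summable fun j : ℕ =>
      j * (-lam * t ^ α) ^ (j - 1) / Real.Gamma (α * j + 1) := by
    refine Summable.of_norm ?_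
    convert ml_summable_deriv hα (abs_nonneg (-lam * t ^ α)) using 2 with j
    rw [norm_div, norm_mul, norm_pow, Real.norm_eq_abs (-lam * t ^ α), Real.norm_natCast,
      Real.norm_of_nonneg (ml_gpos hα j).le]
  rw [hs.tsum_eq_zero_add]
  simp only [Nat.cast_zero, zero_mul, zero_div, zero_add]
  rw [← tsum_mul_right, ← tsum_mul_left]
  congr 1
  ext k
  have hk : (0:ℝ) < α * (k + 1) := by positivity
  have hG := Real.Gamma_pos_of_pos hk
  have hpow : t ^ (α * (k + 1) - 1) = (t ^ α) ^ k * t ^ (α - 1) := by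
    rw [← Real.rpow_natCast, ← Real.rpow_mul ht.le, ← Real.rpow_add ht]
    congr 1; ring
  push_cast
  rw [Real.Gamma_add_one hk.ne', hpow, mul_pow]
  field_simp
  ring

lemma ml_beta {s b t : ℝ} (hs : 0 < s) (hb : 0 < b) (ht : 0 < t) :
    ∫ x in (0:ℝ)..t, x ^ (s - 1) * (t - x) ^ (b - 1) =
      t ^ (s + b - 1) * (Real.Gamma s * Real.Gamma b / Real.Gamma (s + b)) := by
  have h := Complex.betaIntegral_scaled s b ht
  rw [Complex.betaIntegral_eq_Gamma_mul_div _ _ (by simpa) (by simpa)] at h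
  apply Complex.ofReal_injective
  rw [← intervalIntegral.integral_ofReal]
  push_cast
  rw [Complex.ofReal_cpow ht.le, ← Complex.Gamma_ofReal, ← Complex.Gamma_ofReal,
    ← Complex.Gamma_ofReal]
  push_cast
  rw [← h]
  refine intervalIntegral.integral_congr fun x hx => ?_
  rw [Set.uIcc_of_le ht.le] at hx
  rw [Complex.ofReal_cpow hx.1, Complex.ofReal_cpow (by linarith [hx.2])]
  push_cast
  rfl

open MeasureTheory in
theorem mittagLeffler_solves_fractional_relaxation
    (α lam y₀ : ℝ) (hα : 0 < α) (hα1 : α < 1) (hlam : 0 ≤ lam) :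
    (fun t : ℝ => y₀ * mittagLeffler α (-lam * t ^ α)) 0 = y₀ ∧
    (∀ t : ℝ, 0 < t →
      DifferentiableAt ℝ (fun t : ℝ => y₀ * mittagLeffler α (-lam * t ^ α)) t) ∧
    (∀ t : ℝ, 0 < t →
      caputoDeriv α (fun t : ℝ => y₀ * mittagLeffler α (-lam * t ^ α)) t =
        -lam * (y₀ * mittagLeffler α (-lam * t ^ α))) := by
  refine ⟨?_, fun t ht => (ml_sol_hasDerivAt hα lam y₀ ht).differentiableAt, fun t ht => ?_⟩
  · have : mittagLeffler α 0 = 1 := by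
      rw [mittagLeffler, tsum_eq_single 0 (fun j hj => by simp [hj])]
      simp
    simp [Real.zero_rpow hα.ne', this]
  · have hG1 : 0 < Real.Gamma (1 - α) := Real.Gamma_pos_of_pos (by linarith)
    have hgk : ∀ k : ℕ, 0 < Real.Gamma (α * (k + 1)) := fun k =>
      Real.Gamma_pos_of_pos (by positivity)
    have hbeta : ∀ k : ℕ, ∫ x in (0:ℝ)..t, x ^ (α * (k + 1) - 1) * (t - x) ^ (-α) =
        (t ^ α) ^ k * (Real.Gamma (α * (k + 1)) * Real.Gamma (1 - α) /
          Real.Gamma (α * k + 1)) := by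
      intro k
      have := ml_beta (s := α * (k + 1)) (b := 1 - α) (by positivity) (by linarith) ht
      rw [show (1 - α - 1) = -α by ring, show α * (k + 1) + (1 - α) = α * k + 1 by ring,
        show α * k + 1 - 1 = α * k by ring, Real.rpow_mul ht.le, Real.rpow_natCast] at this
      exact this
    have hint : ∀ k : ℕ, IntervalIntegrable
        (fun x : ℝ => x ^ (α * (k + 1) - 1) * (t - x) ^ (-α)) volume 0 t := by
      intro k
      by_contra hc
      have h0 := intervalIntegral.integral_undef hc
      rw [hbeta k] at h0
      have h1 := hgk k
      have h2 := ml_gpos hα k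
      have : 0 < t ^ α := Real.rpow_pos_of_pos ht _
      have : 0 < (t ^ α) ^ k * (Real.Gamma (α * (k + 1)) * Real.Gamma (1 - α) /
          Real.Gamma (α * k + 1)) := by positivity
      exact this.ne' h0
    set c : ℕ → ℝ := fun k => y₀ * (-lam) ^ (k + 1) / Real.Gamma (α * (k + 1)) with hc
    set F : ℕ → ℝ → ℝ := fun k x => c k * (x ^ (α * (k + 1) - 1) * (t - x) ^ (-α)) with hF
    have hnorm : ∀ k, ∫ x in Set.Ioc 0 t, ‖F k x‖ =
        |y₀| * lam * Real.Gamma (1 - α) *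
          ((lam * t ^ α) ^ k / Real.Gamma (α * k + 1)) := by
      intro k
      have : ∫ x in Set.Ioc 0 t, ‖F k x‖ =
          ∫ x in Set.Ioc 0 t, |c k| * (x ^ (α * (k + 1) - 1) * (t - x) ^ (-α)) := by
        refine setIntegral_congr_fun measurableSet_Ioc fun x hx => ?_
        simp only [hF]
        rw [norm_mul, Real.norm_eq_abs, Real.norm_of_nonneg]
        exact mul_nonneg (Real.rpow_nonneg hx.1.le _)
          (Real.rpow_nonneg (by linarith [hx.2]) _)
      rw [this, integral_const_mul, ← intervalIntegral.integral_of_le ht.le, hbeta k]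
      have h1 := hgk k
      have h2 := ml_gpos hα k
      simp only [hc]
      rw [abs_div, abs_mul, abs_pow, abs_neg, abs_of_nonneg hlam, abs_of_pos h1, mul_pow]
      field_simp
      ring
    have hsum := hasSum_integral_of_summable_integral_norm (μ := volume.restrict (Set.Ioc 0 t))
      (F := F) (fun k => ((hint k).1.const_mul (c k))) (by
        simp only [hnorm]
        exact (ml_summable hα _).mul_left _)
    have hder : ∫ τ in (0:ℝ)..t,
        deriv (fun t : ℝ => y₀ * mittagLeffler α (-lam * t ^ α)) τ * (t - τ) ^ (-α) =
        ∫ x in Set.Ioc 0 t, ∑' k, F k x := by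
      rw [intervalIntegral.integral_of_le ht.le]
      refine setIntegral_congr_fun measurableSet_Ioc fun x hx => ?_
      simp only [hF, (ml_sol_hasDerivAt hα lam y₀ hx.1).deriv]
      rw [← tsum_mul_right]
      simp only [hc, mul_assoc]
    rw [caputoDeriv, hder, ← hsum.tsum_eq, mittagLeffler, ← tsum_mul_left, ← tsum_mul_left,
      ← tsum_mul_left]
    congr 1
    ext k
    have h1 := hgk k
    have h2 := ml_gpos hα k
    simp only [hF]
    rw [integral_const_mul, ← intervalIntegral.integral_of_le ht.le, hbeta k]
    simp only [hc]
    rw [mul_pow]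
    field_simp
    ring
end

section
/- Let 0 < α ≤ 1, a ≥ 0 and u > 0 with u^α > a. Then the Laplace transform of t ↦ E_α(-a t^α) is given by ∫_0^∞ e^{-u t} E_α(-a t^α) dt = u^{α-1} / (u^α + a), the integral converging absolutely. -/
open MeasureTheory

/-- the Laplace transform of `t ↦ E_α(-a tᵅ)` is `u^{α-1}/(u^α + a)`,
the integral converging absolutely. -/
theorem laplaceTransform_mittagLeffler
    (α a u : ℝ) (hα : 0 < α) (hα1 : α ≤ 1) (ha : 0 ≤ a) (hu : 0 < u)
    (hua : a < u ^ α) :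
    IntegrableOn (fun t : ℝ => Real.exp (-u * t) * mittagLeffler α (-a * t ^ α))
      (Set.Ioi 0) ∧
    (∫ t in Set.Ioi (0:ℝ), Real.exp (-u * t) * mittagLeffler α (-a * t ^ α)) =
      u ^ (α - 1) / (u ^ α + a) := by
  have hb : 0 < u ^ α := Real.rpow_pos_of_pos hu α
  have key : ∀ j : ℕ, ∫ t in Set.Ioi (0:ℝ), t ^ ((α * j + 1) - 1) * Real.exp (-(u * t)) =
      (1 / u) ^ (α * j + 1) * Real.Gamma (α * j + 1) := fun j =>
    Real.integral_rpow_mul_exp_neg_mul_Ioi (by positivity) hu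
  have hG : ∀ j : ℕ, 0 < Real.Gamma (α * j + 1) := fun j =>
    Real.Gamma_pos_of_pos (by positivity)
  have hpow : ∀ j : ℕ, (1 / u) ^ (α * j + 1) = u⁻¹ * ((u ^ α)⁻¹) ^ j := by
    intro j
    rw [one_div, Real.rpow_add (by positivity), Real.rpow_one, Real.rpow_mul (by positivity),
      Real.rpow_natCast, Real.inv_rpow hu.le, mul_comm]
  have hint0 : ∀ j : ℕ, IntegrableOn
      (fun t : ℝ => t ^ ((α * j + 1) - 1) * Real.exp (-(u * t))) (Set.Ioi 0) := by
    intro j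
    apply Integrable.of_integral_ne_zero
    rw [key j]
    have := hG j
    positivity
  have hF : ∀ (c : ℝ) (j : ℕ) (t : ℝ), t ∈ Set.Ioi (0:ℝ) →
      Real.exp (-u * t) * ((c * t ^ α) ^ j / Real.Gamma (α * j + 1)) =
      (c ^ j / Real.Gamma (α * j + 1)) * (t ^ ((α * j + 1) - 1) * Real.exp (-(u * t))) := by
    intro c j t ht
    have ht' : (0:ℝ) < t := ht
    rw [add_sub_cancel_right, Real.rpow_mul ht'.le, Real.rpow_natCast, mul_pow, neg_mul]
    ring
  have hI : ∀ (c : ℝ) (j : ℕ), ∫ t in Set.Ioi (0:ℝ),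
      Real.exp (-u * t) * ((c * t ^ α) ^ j / Real.Gamma (α * j + 1)) =
      u⁻¹ * (c * (u ^ α)⁻¹) ^ j := by
    intro c j
    rw [setIntegral_congr_fun measurableSet_Ioi (hF c j), integral_const_mul, key, hpow, mul_pow]
    have := (hG j).ne'
    field_simp
  have hFi : ∀ j : ℕ, IntegrableOn (fun t : ℝ =>
      Real.exp (-u * t) * ((-a * t ^ α) ^ j / Real.Gamma (α * j + 1))) (Set.Ioi 0) := fun j =>
    (integrableOn_congr_fun (hF (-a) j) measurableSet_Ioi).2 ((hint0 j).const_mul _)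
  have hlt : a * (u ^ α)⁻¹ < 1 := by
    rw [← div_eq_mul_inv, div_lt_one hb]; exact hua
  have h0 : 0 ≤ a * (u ^ α)⁻¹ := by positivity
  have hnorm : ∀ j : ℕ, ∫ t in Set.Ioi (0:ℝ),
      ‖Real.exp (-u * t) * ((-a * t ^ α) ^ j / Real.Gamma (α * j + 1))‖ =
      u⁻¹ * (a * (u ^ α)⁻¹) ^ j := by
    intro j
    rw [← hI a j]
    refine setIntegral_congr_fun measurableSet_Ioi fun t ht => ?_
    have ht' : (0:ℝ) < t := ht
    simp only [norm_mul, norm_div, norm_pow, Real.norm_eq_abs, Real.abs_exp, abs_neg,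
      abs_of_pos (hG j), abs_of_nonneg ha, abs_of_pos (Real.rpow_pos_of_pos ht' α)]
  have hs := hasSum_integral_of_summable_integral_norm hFi (by
    simp only [hnorm]
    exact (summable_geometric_of_lt_one h0 hlt).mul_left _)
  simp only [hI, tsum_mul_left] at hs
  have hg := (hasSum_geometric_of_abs_lt_one (r := -a * (u ^ α)⁻¹) (by
    rw [neg_mul, abs_neg, abs_of_nonneg h0]; exact hlt)).mul_left u⁻¹
  have heq : (∫ t in Set.Ioi (0:ℝ), Real.exp (-u * t) * mittagLeffler α (-a * t ^ α)) =
      u ^ (α - 1) / (u ^ α + a) := by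
    unfold mittagLeffler
    rw [hs.unique hg, Real.rpow_sub hu, Real.rpow_one]
    have h1 : u ^ α + a ≠ 0 := by positivity
    have h2 : 1 - -a * (u ^ α)⁻¹ = (u ^ α + a) / u ^ α := by field_simp; ring
    rw [h2, inv_div]
    field_simp
  refine ⟨?_, heq⟩
  apply Integrable.of_integral_ne_zero
  rw [heq]
  positivity
end

section
/- Let s > 1 and let f : ℤ → ℂ be absolutely summable. Then for every m ∈ ℤ the series (L̃(s)f)(m) = ∑_{n ≠ m} (f(m) - f(n)) / |m-n|^s converges absolutely, the resulting function L̃(s)f is absolutely summable, and for every k ∈ ℝ its Fourier series satisfies ∑_{m ∈ ℤ} e^{i m k} (L̃(s)f)(m) = l_s(k) · ∑_{m ∈ ℤ} e^{i m k} f(m), where l_s(k) = 2 ∑_{d=1}^∞ d^{-s} (1 - cos(d k)). -/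
open Complex

/-- `l_s(k) = 2 ∑_{d=1}^∞ d^{-s} (1 - cos(dk))`, the Fourier symbol of the
Mellin-transformed d-path Laplacian on the infinite path graph. -/
noncomputable def lsFun (s k : ℝ) : ℝ :=
  2 * ∑' d : ℕ+, (d : ℝ) ^ (-s) * (1 - Real.cos (d * k))

/-- The Mellin-transformed d-path Laplacian on the infinite path graph ℤ:
`(L̃(s)f)(m) = ∑_{n ≠ m} (f(m) - f(n)) / |m-n|^s`. -/
noncomputable def mellinLaplacianZ (s : ℝ) (f : ℤ → ℂ) (m : ℤ) : ℂ :=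
  ∑' n : {n : ℤ // n ≠ m}, (f m - f n) / (((|m - (n : ℤ)| : ℤ) : ℝ) ^ s : ℝ)

lemma mlz_summable_w (s : ℝ) (hs : 1 < s) :
    Summable (fun d : ℤ => ((((|d| : ℤ) : ℝ) ^ s : ℝ))⁻¹) := by
  refine (Real.summable_abs_int_rpow hs).congr fun d => ?_
  rw [Real.rpow_neg (abs_nonneg _), Int.cast_abs]

lemma mlz_summable_F (s : ℝ) (hs : 1 < s)
    (f : ℤ → ℂ) (hf : Summable (fun n => ‖f n‖)) :
    Summable (fun p : ℤ × ℤ => ‖(f p.1 - f (p.1 - p.2)) / ((((|p.2| : ℤ) : ℝ) ^ s : ℝ) : ℂ)‖) := by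
  have hw := mlz_summable_w s hs
  have h1 : Summable (fun p : ℤ × ℤ => ‖f p.1‖ * ((((|p.2| : ℤ) : ℝ) ^ s : ℝ))⁻¹) :=
    hf.mul_of_nonneg hw (fun _ => norm_nonneg _) (fun _ => by positivity)
  let e : ℤ × ℤ ≃ ℤ × ℤ :=
    { toFun := fun p => (p.1 - p.2, p.2)
      invFun := fun p => (p.1 + p.2, p.2)
      left_inv := fun p => by simp
      right_inv := fun p => by simp }
  have h2 : Summable (fun p : ℤ × ℤ => ‖f (p.1 - p.2)‖ * ((((|p.2| : ℤ) : ℝ) ^ s : ℝ))⁻¹) :=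
    (e.summable_iff).2 h1
  refine Summable.of_nonneg_of_le (fun _ => norm_nonneg _) (fun p => ?_) (h1.add h2)
  have h0 : (0:ℝ) ≤ ((|p.2| : ℤ) : ℝ) ^ s := by positivity
  rw [norm_div, Complex.norm_real, Real.norm_of_nonneg h0, div_eq_mul_inv, ← add_mul]
  gcongr
  exact norm_sub_le _ _

lemma mlz_eq (s : ℝ) (f : ℤ → ℂ) (m : ℤ) :
    mellinLaplacianZ s f m =
      ∑' d : ℤ, (f m - f (m - d)) / ((((|d| : ℤ) : ℝ) ^ s : ℝ) : ℂ) := by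
  unfold mellinLaplacianZ
  rw [← (Equiv.subLeft m).tsum_eq]
  have := tsum_subtype_eq_of_support_subset (s := {n : ℤ | n ≠ m})
    (f := fun n : ℤ => (f m - f n) / ((((|m - n| : ℤ) : ℝ) ^ s : ℝ) : ℂ)) (by
      intro n hn h
      apply hn
      subst h
      simp)
  simp only [Equiv.subLeft_apply, sub_sub_cancel]
  exact this

lemma mlz_symbol (s : ℝ) (hs : 1 < s) (k : ℝ) :
    ∑' d : ℤ, (1 - Complex.exp (Complex.I * d * k)) / ((((|d| : ℤ) : ℝ) ^ s : ℝ) : ℂ)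
      = (lsFun s k : ℂ) := by
  have hw := mlz_summable_w s hs
  have hsum : Summable (fun d : ℤ =>
      (1 - Complex.exp (Complex.I * d * k)) / ((((|d| : ℤ) : ℝ) ^ s : ℝ) : ℂ)) := by
    refine Summable.of_norm_bounded (hw.mul_left 2) (fun d => ?_)
    have h0 : (0:ℝ) ≤ ((|d| : ℤ) : ℝ) ^ s := by positivity
    rw [norm_div, Complex.norm_real, Real.norm_of_nonneg h0, div_eq_mul_inv]
    gcongr
    refine (norm_sub_le _ _).trans ?_
    have : Complex.I * d * k = ((d * k : ℝ) : ℂ) * Complex.I := by push_cast; ring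
    rw [this, Complex.norm_exp_ofReal_mul_I]
    norm_num
  have hinj : Function.Injective (fun n : ℕ+ => ((n : ℕ) : ℤ)) := fun a b h => by simpa using h
  have hinj' : Function.Injective (fun n : ℕ+ => -((n : ℕ) : ℤ)) := fun a b h => by simpa using h
  have hsp := hsum.comp_injective hinj
  have hsn := hsum.comp_injective hinj'
  simp only [Function.comp_def] at hsp hsn
  rw [tsum_int_eq_zero_add_tsum_pnat hsum, add_assoc,
    ← Summable.tsum_add hsp hsn]
  unfold lsFun
  rw [Complex.ofReal_mul, Complex.ofReal_tsum, ← tsum_mul_left]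
  simp only [Int.cast_zero, mul_zero, zero_mul, Complex.exp_zero, sub_self, zero_div, zero_add]
  refine tsum_congr fun d => ?_
  have e1 : Complex.I * (((d : ℕ) : ℤ) : ℂ) * k = ((d : ℝ) * k : ℝ) * Complex.I := by
    push_cast; ring
  have e2 : Complex.I * ((-((d : ℕ) : ℤ) : ℤ) : ℂ) * k = -((d : ℝ) * k : ℝ) * Complex.I := by
    push_cast; ring
  have e3 : (|((d : ℕ) : ℤ)| : ℤ) = ((d : ℕ) : ℤ) := abs_of_nonneg (by positivity)
  rw [e1, e2, abs_neg, e3, Int.cast_natCast, Real.rpow_neg (by positivity)]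
  push_cast
  rw [Complex.cos]
  ring

/-- for `s > 1` and absolutely summable `f : ℤ → ℂ`, the series defining
`L̃(s)f` converges absolutely, `L̃(s)f` is absolutely summable, and its Fourier series
is the multiplication of that of `f` by the symbol `l_s(k)`. -/
theorem mellinLaplacianZ_fourier (s : ℝ) (hs : 1 < s)
    (f : ℤ → ℂ) (hf : Summable (fun n => ‖f n‖)) :
    (∀ m : ℤ, Summable (fun n : {n : ℤ // n ≠ m} =>
        ‖(f m - f n) / (((|m - (n : ℤ)| : ℤ) : ℝ) ^ s : ℝ)‖)) ∧
    Summable (fun m : ℤ => ‖mellinLaplacianZ s f m‖) ∧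
    (∀ k : ℝ,
      ∑' m : ℤ, Complex.exp (Complex.I * m * k) * mellinLaplacianZ s f m =
        (lsFun s k : ℂ) * ∑' m : ℤ, Complex.exp (Complex.I * m * k) * f m) := by
  have hF := mlz_summable_F s hs f hf
  have hw := mlz_summable_w s hs
  refine ⟨fun m => ?_, ?_, fun k => ?_⟩
  · have h1 := hF.prod_factor m
    have h2 := ((Equiv.subLeft m).summable_iff).2 h1
    have h3 := h2.comp_injective (Subtype.val_injective (p := fun n : ℤ => n ≠ m))
    refine h3.congr fun n => ?_
    simp
  · refine Summable.of_nonneg_of_le (fun _ => norm_nonneg _) (fun m => ?_) hF.prod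
    rw [mlz_eq s]
    exact norm_tsum_le_tsum_norm (hF.prod_factor m)
  · have hn : ∀ m : ℤ, ‖Complex.exp (Complex.I * m * k)‖ = 1 := fun m => by
      have : Complex.I * m * k = ((m * k : ℝ) : ℂ) * Complex.I := by push_cast; ring
      rw [this, Complex.norm_exp_ofReal_mul_I]
    have hG : Summable (fun p : ℤ × ℤ => Complex.exp (Complex.I * p.1 * k) *
        ((f p.1 - f (p.1 - p.2)) / ((((|p.2| : ℤ) : ℝ) ^ s : ℝ) : ℂ))) := by
      refine Summable.of_norm (hF.congr fun p => ?_)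
      rw [norm_mul, hn, one_mul]
    have hfe : Summable (fun m : ℤ => Complex.exp (Complex.I * m * k) * f m) := by
      refine Summable.of_norm (hf.congr fun p => ?_)
      rw [norm_mul, hn, one_mul]
    have hshift : ∀ d : ℤ, ∀ m : ℤ, Complex.exp (Complex.I * m * k) * f (m - d) =
        Complex.exp (Complex.I * d * k) *
          (Complex.exp (Complex.I * (m - d : ℤ) * k) * f (m - d)) := fun d m => by
      rw [← mul_assoc, ← Complex.exp_add]
      congr 2
      push_cast
      ring
    simp_rw [mlz_eq s, ← tsum_mul_left]
    rw [← Summable.tsum_comm (f := fun m d : ℤ => Complex.exp (Complex.I * m * k) *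
        ((f m - f (m - d)) / ((((|d| : ℤ) : ℝ) ^ s : ℝ) : ℂ))) hG]
    rw [tsum_mul_left, ← mlz_symbol s hs k, ← tsum_mul_right]
    refine tsum_congr fun d => ?_
    have hs1 : Summable (fun m : ℤ =>
        Complex.exp (Complex.I * (m - d : ℤ) * k) * f (m - d)) :=
      ((Equiv.subRight d).summable_iff (f := fun m : ℤ =>
        Complex.exp (Complex.I * m * k) * f m)).2 hfe
    have ht1 : ∑' m : ℤ, Complex.exp (Complex.I * (m - d : ℤ) * k) * f (m - d) =
        ∑' m : ℤ, Complex.exp (Complex.I * m * k) * f m :=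
      (Equiv.subRight d).tsum_eq (fun m : ℤ => Complex.exp (Complex.I * m * k) * f m)
    simp_rw [← mul_div_assoc, mul_sub, hshift d]
    rw [tsum_div_const, hfe.tsum_sub (hs1.mul_left _), tsum_mul_left, ht1]
    ring
end

section
/- Let 1 < s < 3. Then l_s(k) ~ c_s · |k|^{s-1} as k → 0, where c_s = -π / (Γ(s) · cos(sπ/2)) > 0; precisely, lim_{k → 0⁺} l_s(k) / k^{s-1} = -π / (Γ(s) · cos(sπ/2)). -/
open Real Filter

noncomputable def lsG (k u : ℝ) : ℝ :=
  Real.cosh (k * u / 2) / Real.sinh (k * u / 2) * (1 - Real.cos k) /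
    (4 * Real.sinh (k * u / 2) ^ 2 + 2 * (1 - Real.cos k))

lemma lsG_hasSum (k u : ℝ) (hk : 0 < k) (hu : 0 < u) :
    HasSum (fun d : ℕ+ => (1 - Real.cos (d * k)) * Real.exp (-(d * k) * u)) (lsG k u) := by
  set q := Real.exp (-(k * u)) with hq
  have hq0 : 0 < q := Real.exp_pos _
  have hq1 : q < 1 := by
    rw [hq, Real.exp_lt_one_iff]; have := mul_pos hk hu; linarith
  set z : ℂ := q * Complex.exp (k * Complex.I) with hz
  have hzn : ‖z‖ < 1 := by
    rw [hz, norm_mul, Complex.norm_exp_ofReal_mul_I, mul_one, Complex.norm_real, Real.norm_of_nonneg hq0.le]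
    exact hq1
  have h1 := Complex.hasSum_re (hasSum_geometric_of_norm_lt_one hzn)
  have h2 := (hasSum_geometric_of_lt_one hq0.le hq1).sub h1
  have hzre : z.re = q * Real.cos k := by
    rw [hz, Complex.re_ofReal_mul, Complex.exp_ofReal_mul_I_re]
  have hzim : z.im = q * Real.sin k := by
    rw [hz, Complex.im_ofReal_mul, Complex.exp_ofReal_mul_I_im]
  have hterm : ∀ n : ℕ, q ^ n - (z ^ n).re = (1 - Real.cos (n * k)) * Real.exp (-(n * k) * u) := by
    intro n
    have e1 : q ^ n = Real.exp (-(n * k) * u) := by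
      rw [hq, ← Real.exp_nat_mul]; congr 1; ring
    have e2 : z ^ n = (q ^ n : ℝ) * Complex.exp ((n * k : ℝ) * Complex.I) := by
      rw [hz, mul_pow, ← Complex.exp_nat_mul]; push_cast; congr 2; ring
    rw [e2, Complex.re_ofReal_mul, Complex.exp_ofReal_mul_I_re, e1]; ring
  simp_rw [hterm] at h2
  have hval : (1 - q)⁻¹ - ((1 - z)⁻¹).re = lsG k u := by
    rw [Complex.inv_re, Complex.normSq_apply]
    simp only [Complex.sub_re, Complex.sub_im, Complex.one_re, Complex.one_im, hzre, hzim]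
    set p := Real.exp (-(k * u / 2)) with hp
    have hp0 : 0 < p := Real.exp_pos _
    have hqp : q = p ^ 2 := by rw [hq, hp, ← Real.exp_nat_mul]; congr 1; push_cast; ring
    have hpe : Real.exp (k * u / 2) = p⁻¹ := by rw [hp, Real.exp_neg, inv_inv]
    have hp1 : p ^ 2 < 1 := hqp ▸ hq1
    rw [lsG, Real.cosh_eq, Real.sinh_eq, hpe, ← hp, hqp]
    have hs := Real.sin_sq_add_cos_sq k
    have hc := Real.cos_le_one k
    have hA : 0 < (1 - p ^ 2) ^ 2 + 2 * p ^ 2 * (1 - Real.cos k) := by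
      have : 0 < (1 - p ^ 2) ^ 2 := by apply pow_pos; linarith
      have : 0 ≤ 2 * p ^ 2 * (1 - Real.cos k) := by apply mul_nonneg (by positivity); linarith
      linarith
    have d1 : (1 - p ^ 2 * Real.cos k) * (1 - p ^ 2 * Real.cos k) + (0 - p ^ 2 * Real.sin k) * (0 - p ^ 2 * Real.sin k) = (1 - p ^ 2) ^ 2 + 2 * p ^ 2 * (1 - Real.cos k) := by
      linear_combination p ^ 4 * hs
    have d2 : 4 * ((p⁻¹ - p) / 2) ^ 2 + 2 * (1 - Real.cos k) = ((1 - p ^ 2) ^ 2 + 2 * p ^ 2 * (1 - Real.cos k)) / p ^ 2 := by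
      field_simp; ring
    have d3 : (p⁻¹ + p) / 2 / ((p⁻¹ - p) / 2) = (1 + p ^ 2) / (1 - p ^ 2) := by
      have : p⁻¹ - p = (1 - p ^ 2) / p := by field_simp
      rw [this]
      have : (1 - p ^ 2) ≠ 0 := by linarith
      field_simp
    rw [d1, d2, d3]
    have : (1 - p ^ 2) ≠ 0 := by linarith
    obtain ⟨A, hAd⟩ : ∃ A, A = (1 - p ^ 2) ^ 2 + 2 * p ^ 2 * (1 - Real.cos k) := ⟨_, rfl⟩
    rw [← hAd] at hA ⊢
    have hA' := hA.ne'
    field_simp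
    rw [hAd]
    ring
  rw [hval] at h2
  have := (PNat.coe_injective.hasSum_iff (f := fun n : ℕ => (1 - Real.cos (n * k)) * Real.exp (-(n * k) * u)) (a := lsG k u) ?_).mpr h2
  · exact this
  · intro x hx
    have : x = 0 := by
      by_contra h
      exact hx ⟨⟨x, Nat.pos_of_ne_zero h⟩, rfl⟩
    simp [this]

lemma ls_sinh_bound (x : ℝ) (hx : 0 ≤ x) : 4 * x ^ 2 + x ^ 4 ≤ 4 * Real.sinh x ^ 2 := by
  have h1 : ∀ y : ℝ, 0 ≤ y → y ≤ Real.sinh y := fun y hy => Real.self_le_sinh_iff.mpr hy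
  have h4 := h1 (x / 4) (by linarith)
  have h2 := h1 (x / 2) (by linarith)
  have e1 : Real.sinh x = 2 * Real.sinh (x/2) * Real.cosh (x/2) := by
    rw [← Real.sinh_two_mul]; congr 1; ring
  have e2 : Real.cosh (x/2) = 1 + 2 * Real.sinh (x/4) ^ 2 := by
    have := Real.cosh_two_mul (x/4)
    rw [Real.cosh_sq] at this
    rw [show x / 2 = 2 * (x/4) by ring, this]; ring
  have : x * (1 + x ^ 2 / 8) ≤ Real.sinh x := by
    rw [e1, e2]
    have : (x/4)^2 ≤ Real.sinh (x/4) ^ 2 := by gcongr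
    calc x * (1 + x ^ 2 / 8) = 2 * (x/2) * (1 + 2 * (x/4)^2) := by ring
      _ ≤ _ := by gcongr
  have h5 : (x * (1 + x ^ 2 / 8)) ^ 2 ≤ Real.sinh x ^ 2 := by gcongr
  nlinarith [pow_nonneg hx 6]

lemma lsG_bound (k u : ℝ) (hk : 0 < k) (hk1 : k ≤ 1) (hu : 0 < u) :
    0 ≤ lsG k u ∧ k * lsG k u ≤ 4 / (u * (1 + u ^ 2)) := by
  set c := 1 - Real.cos k with hc
  have hc0 : 0 ≤ c := by have := Real.cos_le_one k; linarith
  have hck : c ≤ k ^ 2 / 2 := by have := Real.one_sub_sq_div_two_le_cos (x := k); linarith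
  set x := k * u / 2 with hx
  have hx0 : 0 < x := by positivity
  have hsh : 0 < Real.sinh x := Real.sinh_pos_iff.mpr hx0
  have hch : 0 < Real.cosh x := Real.cosh_pos x
  have hb := ls_sinh_bound x hx0.le
  unfold lsG
  rw [← hc, ← hx]
  refine ⟨by positivity, ?_⟩
  have h1 : Real.cosh x / Real.sinh x ≤ (1 + x) / x := by
    rw [div_le_div_iff₀ hsh hx0]
    have a1 := Real.cosh_sub_sinh x
    have a2 : Real.exp (-x) ≤ 1 := Real.exp_le_one_iff.mpr (by linarith)
    have a3 : x ≤ Real.sinh x := Real.self_le_sinh_iff.mpr hx0.le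
    nlinarith
  have hD : 0 < 4 * Real.sinh x ^ 2 + 2 * c := by positivity
  have hku : k * ((1 + x) / x) = 2 * (1 + x) / u := by
    rw [hx]; field_simp
  have h2 : 2 * (1 + x) * c * (1 + u ^ 2) ≤ 4 * (4 * Real.sinh x ^ 2 + 2 * c) := by
    have a1 : c * u ^ 2 ≤ 2 * x ^ 2 := by
      have : c * u ^ 2 ≤ k ^ 2 / 2 * u ^ 2 := by gcongr
      rw [hx]; linarith
    have a2 : c ≤ 1 := by nlinarith
    have a3 : 2 * x * c ≤ c + x ^ 2 := by nlinarith [mul_nonneg hc0 (sq_nonneg (x - 1)), sq_nonneg x]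
    have a4 : (1 + x) * (c * u ^ 2) ≤ (1 + x) * (2 * x ^ 2) := by gcongr
    nlinarith [mul_nonneg (sq_nonneg x) (sq_nonneg (x - 1))]
  calc k * (Real.cosh x / Real.sinh x * c / (4 * Real.sinh x ^ 2 + 2 * c))
      ≤ k * ((1 + x) / x * c / (4 * Real.sinh x ^ 2 + 2 * c)) := by gcongr
    _ = (k * ((1 + x) / x)) * c / (4 * Real.sinh x ^ 2 + 2 * c) := by ring
    _ = (2 * (1 + x) * c) / (u * (4 * Real.sinh x ^ 2 + 2 * c)) := by
      rw [hku]; field_simp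
    _ ≤ 4 / (u * (1 + u ^ 2)) := by
      rw [div_le_div_iff₀ (by positivity) (by positivity)]
      nlinarith [mul_le_mul_of_nonneg_left h2 hu.le]

lemma lsG_tendsto (u : ℝ) (hu : 0 < u) :
    Tendsto (fun k => k * lsG k u) (nhdsWithin 0 (Set.Ioi 0)) (nhds (1 / (u * (1 + u ^ 2)))) := by
  have hle : nhdsWithin (0:ℝ) (Set.Ioi 0) ≤ nhdsWithin 0 {0}ᶜ :=
    nhdsWithin_mono _ (fun x hx => ne_of_gt hx)
  have hS : Tendsto (fun k : ℝ => Real.sinh (k * u / 2) / k) (nhdsWithin 0 (Set.Ioi 0)) (nhds (u / 2)) := by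
    have h : HasDerivAt (fun k : ℝ => Real.sinh (k * u / 2)) (u / 2) 0 := by
      have := (((hasDerivAt_id (0:ℝ)).mul_const u).div_const 2).sinh
      simpa using this
    have := (hasDerivAt_iff_tendsto_slope.mp h).mono_left hle
    refine this.congr (fun k => ?_)
    simp [slope_def_field]
  have hSn : Tendsto (fun k : ℝ => Real.sin (k / 2) / k) (nhdsWithin 0 (Set.Ioi 0)) (nhds (1 / 2)) := by
    have h : HasDerivAt (fun k : ℝ => Real.sin (k / 2)) (1 / 2) 0 := by
      have := ((hasDerivAt_id (0:ℝ)).div_const 2).sin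
      simpa using this
    have := (hasDerivAt_iff_tendsto_slope.mp h).mono_left hle
    refine this.congr (fun k => ?_)
    simp [slope_def_field]
  have hC : Tendsto (fun k : ℝ => Real.cosh (k * u / 2)) (nhdsWithin 0 (Set.Ioi 0)) (nhds 1) := by
    have : Continuous (fun k : ℝ => Real.cosh (k * u / 2)) := by fun_prop
    have := (this.tendsto 0).mono_left (nhdsWithin_le_nhds (s := Set.Ioi 0))
    simpa using this
  have h2 : Tendsto (fun k : ℝ => 2 * (Real.sin (k / 2) / k) ^ 2) (nhdsWithin 0 (Set.Ioi 0)) (nhds (2 * (1 / 2) ^ 2)) :=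
    (hSn.pow 2).const_mul 2
  have key := ((hC.div hS (by positivity)).mul h2).div (((hS.pow 2).const_mul 4).add (h2.const_mul 2)) (by positivity)
  have e : (1 / (u / 2) * (2 * (1 / 2) ^ 2) / (4 * (u / 2) ^ 2 + 2 * (2 * (1 / 2) ^ 2))) = 1 / (u * (1 + u ^ 2)) := by
    field_simp; ring
  rw [e] at key
  refine key.congr' ?_
  filter_upwards [self_mem_nhdsWithin] with k hk
  have hk : 0 < k := hk
  have hc : 1 - Real.cos k = 2 * Real.sin (k / 2) ^ 2 := by
    have := Real.cos_two_mul (k / 2)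
    rw [show 2 * (k / 2) = k by ring] at this
    have := Real.sin_sq_add_cos_sq (k/2)
    linarith
  have hsh : 0 < Real.sinh (k * u / 2) := Real.sinh_pos_iff.mpr (by positivity)
  have : 0 < 4 * Real.sinh (k * u / 2) ^ 2 + 2 * (2 * Real.sin (k / 2) ^ 2) := by positivity
  simp only [lsG, hc, Pi.div_apply]
  field_simp

open MeasureTheory in
lemma ls_integral (s : ℝ) (hs1 : 1 < s) (hs3 : s < 3) :
    ∫ u in Set.Ioi (0:ℝ), u ^ (s - 1) * (1 / (u * (1 + u ^ 2))) =
      π / 2 / Real.sin (π * ((s - 1) / 2)) := by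
  set a := (s - 1) / 2 with ha
  have ha0 : 0 < a := by rw [ha]; linarith
  have ha1 : a < 1 := by rw [ha]; linarith
  have hB := ProbabilityTheory.beta_eq_betaIntegralReal a (1 - a) ha0 (by linarith)
  have hG : ProbabilityTheory.beta a (1 - a) = π / Real.sin (π * a) := by
    rw [ProbabilityTheory.beta, Real.Gamma_mul_Gamma_one_sub]; simp
  have hI : (Complex.betaIntegral a ((1 - a : ℝ) : ℂ)).re =
      ∫ x in Set.Ioo (0:ℝ) 1, x ^ (a - 1) * (1 - x) ^ (-a) := by
    have : Complex.betaIntegral a ((1 - a : ℝ) : ℂ) =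
        ((∫ x in Set.Ioo (0:ℝ) 1, x ^ (a - 1) * (1 - x) ^ (-a) : ℝ) : ℂ) := by
      rw [Complex.betaIntegral, intervalIntegral.integral_of_le zero_le_one,
        integral_Ioc_eq_integral_Ioo, ← integral_complex_ofReal]
      refine setIntegral_congr_fun measurableSet_Ioo (fun x hx => ?_)
      have h0 : 0 ≤ x := hx.1.le
      have h1 : 0 ≤ 1 - x := by linarith [hx.2]
      simp only [Complex.ofReal_mul, Complex.ofReal_cpow h0, Complex.ofReal_cpow h1]
      push_cast
      congr 2
      ring
    rw [this, Complex.ofReal_re]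
  have himg : (fun u : ℝ => u ^ 2 / (1 + u ^ 2)) '' Set.Ioi 0 = Set.Ioo 0 1 := by
    ext y
    constructor
    · rintro ⟨u, hu, rfl⟩
      have hu : 0 < u := hu
      refine ⟨by positivity, ?_⟩
      simp only
      rw [div_lt_one (by positivity)]; linarith
    · rintro ⟨h0, h1⟩
      have h1' : 0 < 1 - y := by linarith
      refine ⟨Real.sqrt (y / (1 - y)), Real.sqrt_pos.mpr (by positivity), ?_⟩
      simp only
      rw [Real.sq_sqrt (by positivity)]
      field_simp
      ring
  have hinj : Set.InjOn (fun u : ℝ => u ^ 2 / (1 + u ^ 2)) (Set.Ioi 0) := by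
    intro x hx y hy h
    have hx : 0 < x := hx
    have hy : 0 < y := hy
    simp only at h
    rw [div_eq_div_iff (by positivity) (by positivity)] at h
    have : x ^ 2 = y ^ 2 := by linarith
    exact (sq_eq_sq₀ hx.le hy.le).mp this
  have hder : ∀ x ∈ Set.Ioi (0:ℝ), HasDerivWithinAt (fun u : ℝ => u ^ 2 / (1 + u ^ 2))
      (2 * x / (1 + x ^ 2) ^ 2) (Set.Ioi 0) x := by
    intro x hx
    have h := ((hasDerivAt_pow 2 x).div ((hasDerivAt_pow 2 x).const_add 1) (by positivity))
    refine (h.congr_deriv ?_).hasDerivWithinAt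
    field_simp
    simp
    ring
  have hcv := integral_image_eq_integral_abs_deriv_smul measurableSet_Ioi hder hinj
    (fun x : ℝ => x ^ (a - 1) * (1 - x) ^ (-a))
  rw [himg, ← hI, ← hB, hG] at hcv
  have hcv2 : ∫ x in Set.Ioi (0:ℝ), |2 * x / (1 + x ^ 2) ^ 2| • ((x ^ 2 / (1 + x ^ 2)) ^ (a - 1) * (1 - x ^ 2 / (1 + x ^ 2)) ^ (-a)) =
      ∫ u in Set.Ioi (0:ℝ), 2 * (u ^ (s - 1) * (1 / (u * (1 + u ^ 2)))) := by
    refine setIntegral_congr_fun measurableSet_Ioi (fun x hx => ?_)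
    have hx : 0 < x := hx
    have hp : 0 < 1 + x ^ 2 := by positivity
    have e1 : 1 - x ^ 2 / (1 + x ^ 2) = (1 + x ^ 2)⁻¹ := by field_simp; ring
    simp only [smul_eq_mul]
    rw [abs_of_pos (by positivity), e1, Real.div_rpow (by positivity) hp.le,
      Real.inv_rpow hp.le, Real.rpow_neg hp.le, inv_inv, Real.rpow_sub hp, Real.rpow_one,
      ← Real.rpow_natCast x 2, ← Real.rpow_mul hx.le, Real.rpow_natCast,
      show ((2:ℕ):ℝ) * (a - 1) = (s - 1) - 2 by rw [ha]; push_cast; ring,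
      Real.rpow_sub hx, show x ^ (2:ℝ) = x ^ 2 from Real.rpow_natCast x 2]
    have : (1 + x ^ 2) ^ a ≠ 0 := (Real.rpow_pos_of_pos hp a).ne'
    field_simp
  rw [hcv2, integral_const_mul] at hcv
  rw [div_right_comm, hcv]; ring

open MeasureTheory in
lemma ls_eq (s k : ℝ) (hs1 : 1 < s) (hk : 0 < k) :
    lsFun s k / k ^ (s - 1) =
      2 / Real.Gamma s * ∫ u in Set.Ioi (0:ℝ), u ^ (s - 1) * (k * lsG k u) := by
  have hG : 0 < Real.Gamma s := Real.Gamma_pos_of_pos (by linarith)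
  have hdk : ∀ d : ℕ+, 0 < (d:ℝ) * k := fun d => by
    have : (0:ℝ) < d := by exact_mod_cast d.pos
    positivity
  have hsum : Summable (fun d : ℕ+ => ‖((1 - Real.cos (d * k) : ℝ) : ℂ)‖ / ((d:ℝ) * k) ^ (s:ℂ).re) := by
    have h0 : Summable (fun d : ℕ+ => (2 / k ^ s) * (1 / (d:ℝ) ^ s)) :=
      (((Real.summable_one_div_nat_rpow.mpr hs1).comp_injective PNat.coe_injective)).mul_left _
    refine h0.of_nonneg_of_le (fun d => ?_) (fun d => ?_)
    · have := hdk d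
      positivity
    · have h1 : ‖((1 - Real.cos (d * k) : ℝ) : ℂ)‖ ≤ 2 := by
        rw [Complex.norm_real, Real.norm_eq_abs, abs_le]
        constructor <;> linarith [Real.cos_le_one (d * k), Real.neg_one_le_cos (d * k)]
      have hd : (0:ℝ) < d := by exact_mod_cast d.pos
      rw [Complex.ofReal_re, Real.mul_rpow hd.le hk.le]
      calc _ ≤ 2 / ((d:ℝ) ^ s * k ^ s) := by gcongr
        _ = _ := by field_simp
  have h := hasSum_mellin (ι := ℕ+) (a := fun d => ((1 - Real.cos (d * k) : ℝ) : ℂ))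
    (p := fun d => (d:ℝ) * k) (F := fun u => (lsG k u : ℂ)) (s := (s:ℂ))
    (fun d => Or.inr (hdk d)) (by simp; linarith)
    (fun t ht => by
      have := Complex.hasSum_ofReal.mpr (lsG_hasSum k t hk ht)
      convert this using 2
      push_cast
      rfl) hsum
  have hm : mellin (fun u => (lsG k u : ℂ)) s =
      ((∫ u in Set.Ioi (0:ℝ), u ^ (s - 1) * lsG k u : ℝ) : ℂ) := by
    rw [mellin, ← integral_complex_ofReal]
    refine setIntegral_congr_fun measurableSet_Ioi (fun x hx => ?_)
    have hx : 0 < x := hx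
    simp only [Complex.ofReal_mul, Complex.ofReal_cpow hx.le, smul_eq_mul]
    push_cast
    rfl
  rw [hm] at h
  have h2 : HasSum (fun d : ℕ+ => Real.Gamma s / k ^ s * ((d : ℝ) ^ (-s) * (1 - Real.cos (d * k))))
      (∫ u in Set.Ioi (0:ℝ), u ^ (s - 1) * lsG k u) := by
    rw [← Complex.hasSum_ofReal]
    convert h using 2 with d
    have hd : (0:ℝ) < d := by exact_mod_cast d.pos
    rw [← Complex.ofReal_cpow (hdk d).le, Complex.Gamma_ofReal, ← Complex.ofReal_mul,
      ← Complex.ofReal_div, Real.mul_rpow hd.le hk.le, Real.rpow_neg hd.le]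
    congr 1
    field_simp
  have h3 := h2.tsum_eq
  rw [tsum_mul_left] at h3
  have h4 : ∫ u in Set.Ioi (0:ℝ), u ^ (s - 1) * (k * lsG k u) =
      k * ∫ u in Set.Ioi (0:ℝ), u ^ (s - 1) * lsG k u := by
    rw [← integral_const_mul]
    congr 1
    ext u
    ring
  rw [h4, ← h3, lsFun, Real.rpow_sub hk, Real.rpow_one]
  have : k ^ s ≠ 0 := (Real.rpow_pos_of_pos hk s).ne'
  generalize (∑' d : ℕ+, (d : ℝ) ^ (-s) * (1 - Real.cos (d * k))) = S
  field_simp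

open MeasureTheory in
theorem lsFun_asymptotics_small_s (s : ℝ) (hs1 : 1 < s) (hs3 : s < 3) :
    0 < -π / (Real.Gamma s * Real.cos (s * π / 2)) ∧
    Tendsto (fun k : ℝ => lsFun s k / k ^ (s - 1)) (nhdsWithin 0 (Set.Ioi 0))
      (nhds (-π / (Real.Gamma s * Real.cos (s * π / 2)))) := by
  have hG : 0 < Real.Gamma s := Real.Gamma_pos_of_pos (by linarith)
  have hsin : 0 < Real.sin (π * ((s - 1) / 2)) := by
    apply Real.sin_pos_of_pos_of_lt_pi
    · have := Real.pi_pos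
      have : 0 < (s - 1) / 2 := by linarith
      positivity
    · nlinarith [Real.pi_pos]
  have hcos : Real.cos (s * π / 2) = - Real.sin (π * ((s - 1) / 2)) := by
    rw [show π * ((s - 1) / 2) = s * π / 2 - π / 2 by ring, Real.sin_sub_pi_div_two, neg_neg]
  have hval : -π / (Real.Gamma s * Real.cos (s * π / 2)) =
      2 / Real.Gamma s * (π / 2 / Real.sin (π * ((s - 1) / 2))) := by
    rw [hcos]; field_simp
  rw [hval]
  have hpi := Real.pi_pos
  refine ⟨by positivity, ?_⟩
  have hI := ls_integral s hs1 hs3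
  have hint : Integrable (fun u : ℝ => u ^ (s - 1) * (1 / (u * (1 + u ^ 2))))
      (volume.restrict (Set.Ioi 0)) := by
    apply Integrable.of_integral_ne_zero
    rw [hI]; positivity
  have hk1 : ∀ᶠ k : ℝ in nhdsWithin 0 (Set.Ioi 0), k ≤ 1 :=
    nhdsWithin_le_nhds (Iic_mem_nhds one_pos)
  have key : Tendsto (fun k : ℝ => ∫ u in Set.Ioi (0:ℝ), u ^ (s - 1) * (k * lsG k u))
      (nhdsWithin 0 (Set.Ioi 0)) (nhds (∫ u in Set.Ioi (0:ℝ), u ^ (s - 1) * (1 / (u * (1 + u ^ 2))))) := by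
    refine tendsto_integral_filter_of_dominated_convergence
      (fun u => 4 * (u ^ (s - 1) * (1 / (u * (1 + u ^ 2))))) ?_ ?_ (hint.const_mul 4) ?_
    · refine Eventually.of_forall (fun k => Measurable.aestronglyMeasurable ?_)
      unfold lsG
      have h1 : Measurable Real.sinh := Real.continuous_sinh.measurable
      have h2 : Measurable Real.cosh := Real.continuous_cosh.measurable
      fun_prop
    · filter_upwards [hk1, self_mem_nhdsWithin] with k hk1 hk
      filter_upwards [ae_restrict_mem measurableSet_Ioi] with u hu
      have hk : 0 < k := hk
      have hu : 0 < u := hu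
      obtain ⟨b0, b1⟩ := lsG_bound k u hk hk1 hu
      rw [Real.norm_of_nonneg (by positivity)]
      calc _ ≤ u ^ (s - 1) * (4 / (u * (1 + u ^ 2))) := by gcongr
        _ = _ := by ring
    · filter_upwards [ae_restrict_mem measurableSet_Ioi] with u hu
      exact (lsG_tendsto u hu).const_mul _
  rw [hI] at key
  refine (key.const_mul (2 / Real.Gamma s)).congr' ?_
  filter_upwards [self_mem_nhdsWithin] with k hk
  exact (ls_eq s k hs1 hk).symm
end

section
/- Let s > 3. Then l_s(k) ~ ζ(s-2) · k² as k → 0; precisely, lim_{k → 0, k ≠ 0} l_s(k) / k² = ζ(s-2), where ζ is the Riemann zeta function. -/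
open Real Filter

/-- for `s > 3`, `l_s(k) ~ ζ(s-2) k²` as `k → 0`. -/
theorem lsFun_asymptotics_large_s (s : ℝ) (hs : 3 < s) :
    Tendsto (fun k : ℝ => lsFun s k / k ^ 2) (nhdsWithin 0 {0}ᶜ)
      (nhds (zetaReal (s - 2))) := by
  have hsum : Summable (fun d : ℕ+ => ((d : ℕ) : ℝ) ^ (-(s - 2))) :=
    (Real.summable_nat_rpow.mpr (by linarith : -(s - 2) < -1)).comp_injective
      PNat.coe_injective
  have key : Tendsto (fun k : ℝ => ∑' d : ℕ+, ((d : ℕ) : ℝ) ^ (-(s - 2)) *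
      (Real.sinc (((d : ℕ) : ℝ) * k / 2)) ^ 2) (nhdsWithin 0 {0}ᶜ)
      (nhds (zetaReal (s - 2))) := by
    unfold zetaReal
    refine tendsto_tsum_of_dominated_convergence hsum ?_ ?_
    · intro d
      have hc : Continuous (fun k : ℝ => ((d : ℕ) : ℝ) ^ (-(s - 2)) *
          (Real.sinc (((d : ℕ) : ℝ) * k / 2)) ^ 2) := by
        have := Real.continuous_sinc
        exact continuous_const.mul ((this.comp (by fun_prop)).pow 2)
      have h := hc.tendsto 0
      simp only [mul_zero, zero_div, Real.sinc_zero, one_pow, mul_one] at h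
      exact h.mono_left nhdsWithin_le_nhds
    · refine Eventually.of_forall fun k d => ?_
      have h0 : (0 : ℝ) ≤ ((d : ℕ) : ℝ) ^ (-(s - 2)) := by positivity
      rw [Real.norm_of_nonneg (by positivity)]
      refine mul_le_of_le_one_right h0 ?_
      exact (sq_le_one_iff_abs_le_one _).mpr (Real.abs_sinc_le_one _)
  refine key.congr' ?_
  filter_upwards [self_mem_nhdsWithin] with k hk
  have hk : k ≠ 0 := hk
  unfold lsFun
  rw [← tsum_mul_left, ← tsum_div_const]
  refine tsum_congr fun d => ?_
  have hd : (0 : ℝ) < ((d : ℕ) : ℝ) := by exact_mod_cast d.pos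
  have e1 : ((d : ℕ) : ℝ) ^ (-(s - 2)) = ((d : ℕ) : ℝ) ^ (-s) * ((d : ℕ) : ℝ) ^ 2 := by
    rw [← Real.rpow_natCast (((d : ℕ) : ℝ)) 2, ← Real.rpow_add hd]
    congr 1
    push_cast
    ring
  have e2 : Real.cos (((d : ℕ) : ℝ) * k) = 1 - 2 * Real.sin (((d : ℕ) : ℝ) * k / 2) ^ 2 := by
    have h := Real.cos_two_mul (((d : ℕ) : ℝ) * k / 2)
    have h2 := Real.sin_sq_add_cos_sq (((d : ℕ) : ℝ) * k / 2)
    rw [mul_div_cancel₀ _ (two_ne_zero)] at h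
    linarith
  rw [e1, e2, Real.sinc_of_ne_zero (by positivity)]
  field_simp
  ring
end

section
/- Let 0 < α ≤ 1, 1 < β ≤ 2 and c > 0, and let l : [-π, π] → ℝ be continuous with l(k) > 0 for all k ≠ 0 and lim_{k → 0} l(k)/|k|^β = c. Then the integral I₀(α,β) = ∫_0^∞ u^{(1-β)/β} E_α(-u) du converges, and for every m ∈ ℤ, lim_{t → ∞} t^{α/β} · (1/2π) ∫_{-π}^{π} e^{-i k m} E_α(-t^α · l(k)) dk = (1/(πβ)) · c^{-1/β} · I₀(α,β). In particular, the solution of the generalized diffusion equation decays asymptotically as t^{-α/β}. -/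
open Real Filter MeasureTheory Set

/-- coefficients of `(1-z)^{-r}` -/
noncomputable def wc (r : ℝ) : ℕ → ℝ
  | 0 => 1
  | n + 1 => (r + n) / (n + 1) * wc r n

lemma wc_zero (r : ℝ) : wc r 0 = 1 := rfl
lemma wc_succ (r : ℝ) (n : ℕ) : wc r (n + 1) = (r + n) / (n + 1) * wc r n := rfl

lemma wc_nonneg {r : ℝ} (hr : 0 ≤ r) (n : ℕ) : 0 ≤ wc r n := by
  induction n with
  | zero => simp [wc_zero]
  | succ n ih => rw [wc_succ]; positivity

lemma wc_neg_nonpos {a : ℝ} (ha : 0 < a) (ha1 : a ≤ 1) (n : ℕ) : wc (-a) (n + 1) ≤ 0 := by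
  induction n with
  | zero => simp [wc_succ, wc_zero, ha.le]
  | succ n ih =>
    rw [wc_succ]
    apply mul_nonpos_of_nonneg_of_nonpos _ ih
    apply div_nonneg
    · push_cast
      have : (0:ℝ) ≤ n := n.cast_nonneg
      linarith
    · positivity

noncomputable def wF (r : ℝ) : PowerSeries ℝ := PowerSeries.mk (wc r)

lemma coeff_wF (r : ℝ) (n : ℕ) : PowerSeries.coeff n (wF r) = wc r n := by
  simp [wF]

lemma wF_ode_iff (r : ℝ) (G : PowerSeries ℝ) :
    (1 - PowerSeries.X) * PowerSeries.derivative ℝ G = PowerSeries.C r * G ↔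
    ∀ n : ℕ, PowerSeries.coeff (n+1) G = (r + n) / (n + 1) * PowerSeries.coeff n G := by
  rw [PowerSeries.ext_iff]
  apply forall_congr'
  intro n
  have hn : (n:ℝ) + 1 ≠ 0 := by positivity
  rw [sub_mul, one_mul, map_sub, PowerSeries.coeff_C_mul, PowerSeries.coeff_derivative]
  have : PowerSeries.coeff n (PowerSeries.X * PowerSeries.derivative ℝ G)
      = n * PowerSeries.coeff n G := by
    cases n with
    | zero => simp
    | succ n => rw [PowerSeries.coeff_succ_X_mul, PowerSeries.coeff_derivative]; push_cast; ring
  rw [this, div_mul_eq_mul_div, eq_div_iff hn]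
  constructor <;> intro h <;> linarith

lemma wF_mul (r s : ℝ) : wF r * wF s = wF (r + s) := by
  have h1 := (wF_ode_iff r (wF r)).2 (fun n => by simp only [coeff_wF]; rfl)
  have h2 := (wF_ode_iff s (wF s)).2 (fun n => by simp only [coeff_wF]; rfl)
  have h3 := (wF_ode_iff (r+s) (wF r * wF s)).1 (by
    rw [Derivation.leibniz, smul_eq_mul, smul_eq_mul, map_add]
    linear_combination (wF s) * h1 + (wF r) * h2)
  ext n
  rw [coeff_wF]
  induction n with
  | zero => simp [PowerSeries.coeff_mul, coeff_wF, wc_zero]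
  | succ n ih => rw [h3, ih, wc_succ]

lemma wF_zero : wF 0 = 1 := by
  ext n
  rw [coeff_wF, PowerSeries.coeff_one]
  cases n with
  | zero => simp [wc_zero]
  | succ n =>
    simp only [Nat.add_eq_zero_iff, one_ne_zero, and_false, if_false]
    induction n with
    | zero => simp [wc_succ]
    | succ n ih => rw [wc_succ, ih, mul_zero]

lemma wc_one (n : ℕ) : wc 1 n = 1 := by
  induction n with
  | zero => rfl
  | succ n ih =>
    have hn : (n:ℝ) + 1 ≠ 0 := by positivity
    rw [wc_succ, ih, mul_one, add_comm, div_self hn]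

lemma wF_neg_one : wF (-1) = 1 - PowerSeries.X := by
  have h : wF 1 * (1 - PowerSeries.X) = 1 := by
    have : wF 1 = PowerSeries.mk 1 := by
      ext n; rw [coeff_wF, wc_one]; simp
    rw [this]
    exact PowerSeries.mk_one_mul_one_sub_eq_one ℝ
  have h2 : wF (-1) * wF 1 = 1 := by rw [wF_mul]; simp [wF_zero]
  calc wF (-1) = wF (-1) * (wF 1 * (1 - PowerSeries.X)) := by rw [h, mul_one]
    _ = _ := by rw [← mul_assoc, h2, one_mul]

/-- positivity of solutions of `((1-z)^a + μ) Y = H`. -/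
lemma pos_of_eq {a μ : ℝ} (ha : 0 < a) (ha1 : a ≤ 1) (hμ : 0 < μ) (Y H : PowerSeries ℝ)
    (hH : ∀ n, 0 ≤ PowerSeries.coeff n H)
    (h : (wF (-a) + PowerSeries.C μ) * Y = H) (n : ℕ) : 0 ≤ PowerSeries.coeff n Y := by
  induction n using Nat.strong_induction_on with
  | _ n ih =>
    have h1 := congrArg (PowerSeries.coeff n) h
    rw [add_mul, map_add, PowerSeries.coeff_C_mul, PowerSeries.coeff_mul,
      Finset.Nat.sum_antidiagonal_eq_sum_range_succ_mk, Finset.sum_range_succ'] at h1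
    simp only [coeff_wF, wc_zero, one_mul, Nat.sub_zero] at h1
    have h2 : ∑ k ∈ Finset.range n, wc (-a) (k + 1) * PowerSeries.coeff (n - (k + 1)) Y ≤ 0 := by
      apply Finset.sum_nonpos
      intro k hk
      have := Finset.mem_range.1 hk
      exact mul_nonpos_of_nonpos_of_nonneg (wc_neg_nonpos ha ha1 k) (ih _ (by omega))
    have h3 := hH n
    by_contra hneg
    push Not at hneg
    nlinarith

lemma series_bound {a μ : ℝ} (ha : 0 < a) (ha1 : a ≤ 1) (hμ : 0 < μ) (Y : PowerSeries ℝ)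
    (h : Y + PowerSeries.C μ * (wF a * Y) = wF 1) (n : ℕ) :
    0 ≤ PowerSeries.coeff n Y ∧ PowerSeries.coeff n Y * (1 + μ * wc (a + 1) n) ≤ 1 := by
  have hA : wF (-a) * wF a = 1 := by rw [wF_mul]; simp [wF_zero]
  have hY : (wF (-a) + PowerSeries.C μ) * Y = wF (-a + 1) := by
    rw [← wF_mul, ← h]
    linear_combination (- PowerSeries.C μ * Y) * hA
  have hnn := pos_of_eq ha ha1 hμ Y _ (fun n => by
    rw [coeff_wF]; exact wc_nonneg (by linarith) n) hY
  have hD : (wF (-a) + PowerSeries.C μ) * (1 - (1 - PowerSeries.X) * Y) = PowerSeries.C μ := by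
    have : wF (-1) * wF (-a + 1) = wF (-a) := by rw [wF_mul]; congr 1; ring
    rw [wF_neg_one] at this
    linear_combination (-(1 - PowerSeries.X)) * hY - this
  have hg := pos_of_eq ha ha1 hμ _ _ (fun n => by
    rw [PowerSeries.coeff_C]; split_ifs <;> linarith) hD
  have hanti : Antitone (fun n => PowerSeries.coeff n Y) := by
    apply antitone_nat_of_succ_le
    intro n
    have := hg (n+1)
    rw [sub_mul, one_mul, map_sub, map_sub, PowerSeries.coeff_succ_X_mul,
      PowerSeries.coeff_one] at this
    simp at this
    linarith
  refine ⟨hnn n, ?_⟩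
  have h1 := congrArg (PowerSeries.coeff n) h
  rw [map_add, PowerSeries.coeff_C_mul, coeff_wF, wc_one, PowerSeries.coeff_mul] at h1
  have h2 : wc (a + 1) n = ∑ p ∈ Finset.HasAntidiagonal.antidiagonal n, wc a p.1 := by
    rw [← coeff_wF, ← wF_mul, PowerSeries.coeff_mul]
    simp [coeff_wF, wc_one]
  have h3 : wc (a + 1) n * PowerSeries.coeff n Y ≤
      ∑ p ∈ Finset.HasAntidiagonal.antidiagonal n, PowerSeries.coeff p.1 (wF a) * PowerSeries.coeff p.2 Y := by
    rw [h2, Finset.sum_mul]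
    apply Finset.sum_le_sum
    intro p hp
    rw [coeff_wF]
    exact mul_le_mul_of_nonneg_left (hanti (by
      have := Finset.HasAntidiagonal.mem_antidiagonal.1 hp; omega)) (wc_nonneg ha.le _)
  nlinarith

/-! bounds on `wc (a+1) n` -/

lemma wc_ratio {a : ℝ} (ha : 0 ≤ a) {n N : ℕ} (hN : 1 ≤ N) (hn : N ≤ n) :
    wc (a + 1) n / (n : ℝ) ^ a ≤ wc (a + 1) N / (N : ℝ) ^ a := by
  induction n, hn using Nat.le_induction with
  | base => exact le_rfl
  | succ n hn ih =>
    refine le_trans ?_ ih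
    have hn0 : (0:ℝ) < n := by exact_mod_cast (by omega : 0 < n)
    have hw := wc_nonneg (by linarith : 0 ≤ a + 1) n
    rw [wc_succ, div_le_div_iff₀ (by positivity) (by positivity)]
    have key : (a + 1 + n) / (n + 1) * (n:ℝ) ^ a ≤ ((n:ℝ) + 1) ^ a := by
      have e1 : (a + 1 + n) / ((n:ℝ) + 1) = a / (n + 1) + 1 := by field_simp; ring
      have e2 : a / ((n:ℝ) + 1) + 1 ≤ Real.exp (a / (n + 1)) := Real.add_one_le_exp _
      have e3 : Real.exp (1 / ((n:ℝ) + 1)) ≤ (n + 1) / n := by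
        have := Real.add_one_le_exp (-(1 / ((n:ℝ) + 1)))
        rw [Real.exp_neg] at this
        have h4 : -(1 / ((n:ℝ) + 1)) + 1 = n / (n + 1) := by field_simp; ring
        rw [h4, le_inv_comm₀ (by positivity) (by positivity), inv_div] at this
        exact this
      have e4 : Real.exp (a / (n + 1)) ≤ ((n + 1) / (n:ℝ)) ^ a := by
        have : Real.exp (a / ((n:ℝ) + 1)) = Real.exp (1 / ((n:ℝ) + 1)) ^ a := by
          rw [← Real.exp_mul]; congr 1; ring
        rw [this]
        exact Real.rpow_le_rpow (by positivity) e3 ha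
      rw [e1]
      calc _ ≤ ((n + 1) / (n:ℝ)) ^ a * (n:ℝ) ^ a := by gcongr; linarith
        _ = _ := by rw [← Real.mul_rpow (by positivity) (by positivity)]; congr 1; field_simp
    push_cast
    nlinarith

lemma wc_le {a : ℝ} (ha : 0 ≤ a) (n : ℕ) : wc (a + 1) n ≤ (1 + a) ^ n := by
  induction n with
  | zero => simp [wc_zero]
  | succ n ih =>
    rw [wc_succ, pow_succ']
    have := wc_nonneg (by linarith : 0 ≤ a + 1) n
    apply mul_le_mul _ ih this (by linarith)
    rw [div_le_iff₀ (by positivity)]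
    have : (0:ℝ) ≤ n := n.cast_nonneg
    nlinarith

lemma wc_tendsto {a : ℝ} (ha : 0 ≤ a) :
    Tendsto (fun n : ℕ => wc (a + 1) n / (n : ℝ) ^ a) atTop (nhds (1 / Real.Gamma (a + 1))) := by
  rcases ha.eq_or_lt with rfl | ha
  · simp [wc_one]
  have h := (Real.GammaSeq_tendsto_Gamma a).const_mul a
  rw [← Real.Gamma_add_one ha.ne'] at h
  have h2 := h.inv₀ (Real.Gamma_pos_of_pos (by linarith)).ne'
  rw [one_div]
  refine h2.congr' ?_
  filter_upwards [eventually_ge_atTop 1] with n hn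
  have hn0 : (0:ℝ) < n := by exact_mod_cast hn
  have : ∀ n : ℕ, a * wc (a + 1) n * (n.factorial : ℝ) = ∏ j ∈ Finset.range (n + 1), (a + j) := by
    intro n
    induction n with
    | zero => simp [wc_zero]
    | succ n ih =>
      rw [Finset.prod_range_succ, ← ih, wc_succ, Nat.factorial_succ]
      have hn : (n:ℝ) + 1 ≠ 0 := by positivity
      push_cast
      field_simp
      ring
  unfold Real.GammaSeq
  rw [← this]
  have hf : (n.factorial : ℝ) ≠ 0 := by positivity
  have hw := wc_nonneg (by linarith : 0 ≤ a + 1) n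
  have hp : (n:ℝ) ^ a ≠ 0 := by positivity
  field_simp

lemma summable_base {α r : ℝ} (hα : 0 < α) (hα1 : α ≤ 1) (hr : 0 < r) (hr1 : r < 1) (m : ℕ) :
    Summable (fun j : ℕ => r ^ j * wc (α * j + 1) m) := by
  have h := summable_pow_mul_geometric_of_norm_lt_one (R := ℝ) m (r := r)
    (by rw [Real.norm_of_nonneg hr.le]; exact hr1)
  have h1 := ((summable_nat_add_iff 1).2 h).mul_left r⁻¹
  refine Summable.of_nonneg_of_le (fun j => ?_) (fun j => ?_) h1
  · exact mul_nonneg (by positivity) (wc_nonneg (by positivity) m)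
  · have h2 := wc_le (a := α * j) (by positivity) m
    have h3 : (1 + α * j) ^ m ≤ ((j:ℝ) + 1) ^ m := by
      apply pow_le_pow_left₀ (by positivity)
      have : (0:ℝ) ≤ j := j.cast_nonneg
      nlinarith
    calc r ^ j * wc (α * j + 1) m ≤ r ^ j * ((j:ℝ) + 1) ^ m := by gcongr; linarith
      _ = _ := by push_cast; rw [pow_succ]; field_simp

lemma rpow_conv {α : ℝ} {R : ℝ} (N : ℕ) (j : ℕ) (hN : 1 ≤ N) (w : ℝ) :
    (R / (N:ℝ) ^ α) ^ j * w = R ^ j * (w / (N:ℝ) ^ (α * j)) := by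
  have hN0 : (0:ℝ) < N := by exact_mod_cast hN
  rw [Real.rpow_mul hN0.le, Real.rpow_natCast, div_pow]
  ring

lemma summable_dom {α R : ℝ} (hα : 0 < α) (hα1 : α ≤ 1) (hR : 0 < R) {N : ℕ} (hN : 1 ≤ N)
    (hRN : R < (N:ℝ) ^ α) :
    Summable (fun j : ℕ => R ^ j * (wc (α * j + 1) N / (N:ℝ) ^ (α * j))) := by
  have hN0 : (0:ℝ) < N := by exact_mod_cast hN
  have := summable_base hα hα1 (r := R / (N:ℝ) ^ α) (by positivity)
    ((div_lt_one (by positivity)).2 hRN) N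
  simpa only [rpow_conv _ _ hN] using this

lemma exists_N {α : ℝ} (hα : 0 < α) (R : ℝ) : ∃ N : ℕ, 1 ≤ N ∧ R < (N:ℝ) ^ α := by
  have h : Tendsto (fun n : ℕ => (n:ℝ) ^ α) atTop atTop :=
    (tendsto_rpow_atTop hα).comp tendsto_natCast_atTop_atTop
  obtain ⟨N, h1, h2⟩ := ((eventually_ge_atTop 1).and (h.eventually_gt_atTop R)).exists
  exact ⟨N, h1, h2⟩

lemma inv_gamma_le {a : ℝ} (ha : 0 ≤ a) {N : ℕ} (hN : 1 ≤ N) :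
    1 / Real.Gamma (a + 1) ≤ wc (a + 1) N / (N : ℝ) ^ a := by
  apply le_of_tendsto (wc_tendsto ha)
  filter_upwards [eventually_ge_atTop N] with n hn
  exact wc_ratio ha hN hn

lemma ml_continuous {α : ℝ} (hα : 0 < α) (hα1 : α ≤ 1) : Continuous (mittagLeffler α) := by
  rw [continuous_iff_continuousAt]
  intro x
  have hR : 0 < |x| + 1 := by positivity
  obtain ⟨N, hN, hRN⟩ := exists_N hα (|x| + 1)
  have hc : ContinuousOn (mittagLeffler α) (Metric.ball 0 (|x| + 1)) := by
    unfold mittagLeffler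
    refine continuousOn_tsum (fun j => by fun_prop) (summable_dom hα hα1 hR hN hRN) ?_
    intro j y hy
    have hy' : |y| ≤ |x| + 1 := by simpa using (Metric.mem_ball.1 hy).le
    have hg : 0 < Real.Gamma (α * j + 1) := Real.Gamma_pos_of_pos (by positivity)
    rw [norm_div, norm_pow, Real.norm_eq_abs, Real.norm_of_nonneg hg.le, div_eq_mul_one_div]
    exact mul_le_mul (pow_le_pow_left₀ (abs_nonneg _) hy' _) (inv_gamma_le (by positivity) hN)
      (by positivity) (by positivity)
  exact hc.continuousAt (Metric.isOpen_ball.mem_nhds (by simp))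

lemma approx_bound {α μ : ℝ} (hα : 0 < α) (hα1 : α ≤ 1) (hμ : 0 < μ) (hμ1 : μ < 1) (n : ℕ) :
    0 ≤ ∑' j : ℕ, (-μ) ^ j * wc (α * j + 1) n ∧
    (∑' j : ℕ, (-μ) ^ j * wc (α * j + 1) n) * (1 + μ * wc (α + 1) n) ≤ 1 := by
  have hs : ∀ m, Summable (fun j : ℕ => (-μ) ^ j * wc (α * j + 1) m) := by
    intro m
    apply Summable.of_norm
    refine (summable_base hα hα1 hμ hμ1 m).congr (fun j => ?_)
    rw [norm_mul, norm_pow, norm_neg, Real.norm_of_nonneg hμ.le,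
      Real.norm_of_nonneg (wc_nonneg (by positivity) m)]
  set Y : PowerSeries ℝ := PowerSeries.mk fun m => ∑' j : ℕ, (-μ) ^ j * wc (α * j + 1) m with hY
  have hc : ∀ m, PowerSeries.coeff m Y = ∑' j : ℕ, (-μ) ^ j * wc (α * j + 1) m := by
    intro m; simp [hY]
  rw [← hc]
  apply series_bound hα hα1 hμ
  ext m
  rw [map_add, PowerSeries.coeff_C_mul, coeff_wF, wc_one, PowerSeries.coeff_mul]
  have e : ∑ p ∈ Finset.HasAntidiagonal.antidiagonal m,
      PowerSeries.coeff p.1 (wF α) * PowerSeries.coeff p.2 Y =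
      ∑' j : ℕ, (-μ) ^ j * wc (α * (j + 1 : ℕ) + 1) m := by
    simp only [hc, ← tsum_mul_left]
    rw [← Summable.tsum_finsetSum (fun i _ => (hs _).mul_left _)]
    congr 1
    ext j
    have : wc (α * (j + 1 : ℕ) + 1) m = PowerSeries.coeff m (wF α * wF (α * j + 1)) := by
      rw [wF_mul, coeff_wF]; congr 1; push_cast; ring
    rw [this, PowerSeries.coeff_mul, Finset.mul_sum]
    apply Finset.sum_congr rfl
    intro p _
    simp only [coeff_wF]; ring
  rw [e, hc, (hs m).tsum_eq_zero_add, ← tsum_mul_left]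
  have : ∀ j : ℕ, (-μ) ^ (j+1) * wc (α * (j + 1 : ℕ) + 1) m =
      - (μ * ((-μ) ^ j * wc (α * (j + 1 : ℕ) + 1) m)) := by intro j; ring
  simp only [this, tsum_neg]
  simp [wc_one]

lemma ml_bound {α x : ℝ} (hα : 0 < α) (hα1 : α ≤ 1) (hx : 0 < x) :
    0 ≤ mittagLeffler α (-x) ∧
      mittagLeffler α (-x) * (1 + x * (1 / Real.Gamma (α + 1))) ≤ 1 := by
  obtain ⟨N, hN, hRN⟩ := exists_N hα x
  have hlim : Tendsto (fun n : ℕ => ∑' j : ℕ, (-(x / (n:ℝ) ^ α)) ^ j * wc (α * j + 1) n) atTop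
      (nhds (mittagLeffler α (-x))) := by
    unfold mittagLeffler
    refine tendsto_tsum_of_dominated_convergence (summable_dom hα hα1 hx hN hRN) ?_ ?_
    · intro j
      have h := (wc_tendsto (a := α * j) (by positivity)).const_mul ((-x) ^ j)
      rw [mul_one_div] at h
      refine h.congr' ?_
      filter_upwards [eventually_ge_atTop 1] with n hn
      rw [← neg_div, rpow_conv _ _ hn]
    · filter_upwards [eventually_ge_atTop N] with n hn j
      have hw := wc_nonneg (r := α * j + 1) (by positivity) n
      rw [← neg_div, rpow_conv _ _ (hN.trans hn), norm_mul, norm_pow, norm_neg,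
        Real.norm_of_nonneg hx.le, Real.norm_of_nonneg (by positivity)]
      gcongr ?_ * ?_
      exact wc_ratio (by positivity) hN hn
  have hb : ∀ᶠ n : ℕ in atTop,
      0 ≤ ∑' j : ℕ, (-(x / (n:ℝ) ^ α)) ^ j * wc (α * j + 1) n ∧
      (∑' j : ℕ, (-(x / (n:ℝ) ^ α)) ^ j * wc (α * j + 1) n) *
        (1 + (x / (n:ℝ) ^ α) * wc (α + 1) n) ≤ 1 := by
    filter_upwards [eventually_ge_atTop N] with n hn
    have hN0 : (0:ℝ) < N := by exact_mod_cast hN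
    have hn0 : (0:ℝ) < n := by exact_mod_cast hN.trans hn
    have hlt : x < (n:ℝ) ^ α := hRN.trans_le
      (Real.rpow_le_rpow hN0.le (by exact_mod_cast hn) hα.le)
    exact approx_bound hα hα1 (μ := x / (n:ℝ) ^ α) (by positivity)
      ((div_lt_one (by positivity)).2 hlt) n
  refine ⟨ge_of_tendsto hlim (hb.mono fun n h => h.1), ?_⟩
  have h2 := hlim.mul (((wc_tendsto hα.le).const_mul x).const_add 1)
  refine le_of_tendsto h2 (hb.mono fun n h => ?_)
  have := h.2
  rw [div_mul_eq_mul_div, mul_div_assoc] at this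
  exact this

lemma integrable_bound {β d : ℝ} (hβ : 1 < β) (hd : 0 < d) :
    Integrable (fun s : ℝ => (1 + d * |s| ^ β)⁻¹) := by
  have h := (integrable_one_add_norm (E := ℝ) (μ := volume) (r := β) (by simpa using hβ)).const_mul
    (2 ^ β * (1 + d⁻¹))
  refine h.mono' ?_ (Eventually.of_forall fun s => ?_)
  · have : Continuous fun s : ℝ => |s| ^ β :=
      continuous_abs.rpow_const (fun _ => Or.inr (by linarith))
    exact (by fun_prop : Measurable fun s : ℝ => (1 + d * |s| ^ β)⁻¹).aestronglyMeasurable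
  · have hs : 0 ≤ |s| := abs_nonneg s
    have hp : 0 ≤ |s| ^ β := by positivity
    rw [Real.norm_of_nonneg (by positivity), Real.norm_eq_abs, Real.rpow_neg (by positivity),
      inv_eq_one_div, ← div_eq_mul_inv, div_le_div_iff₀ (by positivity) (by positivity), one_mul]
    have h1 : (1 + |s|) ^ β ≤ 2 ^ β * (1 + |s| ^ β) := by
      rcases le_total |s| 1 with h | h
      · calc (1 + |s|) ^ β ≤ 2 ^ β := Real.rpow_le_rpow (by positivity) (by linarith) (by linarith)
          _ ≤ _ := le_mul_of_one_le_right (by positivity) (by linarith)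
      · calc (1 + |s|) ^ β ≤ (2 * |s|) ^ β :=
              Real.rpow_le_rpow (by positivity) (by linarith) (by linarith)
          _ = 2 ^ β * |s| ^ β := Real.mul_rpow (by norm_num) hs
          _ ≤ _ := by gcongr; linarith
    refine h1.trans ?_
    rw [mul_assoc]
    gcongr
    have : d⁻¹ * d = 1 := inv_mul_cancel₀ hd.ne'
    have h3 : (1 + d⁻¹) * (1 + d * |s| ^ β) = 1 + |s| ^ β + (d⁻¹ + d * |s| ^ β) := by
      linear_combination |s| ^ β * this
    rw [h3]
    have : 0 ≤ d⁻¹ + d * |s| ^ β := by positivity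
    linarith

lemma ml_norm_le {α x y : ℝ} (hα : 0 < α) (hα1 : α ≤ 1) (hy : 0 < y) (hx : y ≤ x) :
    |mittagLeffler α (-x)| ≤ (1 + y * (1 / Real.Gamma (α + 1)))⁻¹ := by
  have hx0 := hy.trans_le hx
  obtain ⟨h1, h2⟩ := ml_bound hα hα1 hx0
  have hg : 0 < Real.Gamma (α + 1) := Real.Gamma_pos_of_pos (by positivity)
  rw [abs_of_nonneg h1, inv_eq_one_div, le_div_iff₀ (by positivity)]
  refine le_trans ?_ h2
  gcongr

lemma ml_integrable {α β c : ℝ} (hα : 0 < α) (hα1 : α ≤ 1) (hβ1 : 1 < β) (hc : 0 < c) :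
    Integrable (fun s : ℝ => mittagLeffler α (-(c * |s| ^ β))) := by
  have hg : 0 < Real.Gamma (α + 1) := Real.Gamma_pos_of_pos (by positivity)
  refine (integrable_bound hβ1 (d := c * (1 / Real.Gamma (α + 1))) (by positivity)).mono' ?_ ?_
  · have : Continuous fun s : ℝ => |s| ^ β :=
      continuous_abs.rpow_const (fun _ => Or.inr (by linarith))
    exact ((ml_continuous hα hα1).comp (by fun_prop)).aestronglyMeasurable
  · filter_upwards [Measure.ae_ne volume (0:ℝ)] with s hs
    have hs' : 0 < |s| := abs_pos.2 hs
    have := ml_norm_le hα hα1 (y := c * |s| ^ β) (by positivity) le_rfl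
    rw [Real.norm_eq_abs]
    refine this.trans_eq ?_
    congr 2; ring

lemma l_lower {β c : ℝ} (hβ1 : 1 < β) (hc : 0 < c)
    (l : ℝ → ℝ) (hl : ContinuousOn l (Icc (-π) π))
    (hlpos : ∀ k ∈ Icc (-π) π, k ≠ 0 → 0 < l k)
    (hlasymp : Tendsto (fun k : ℝ => l k / |k| ^ β) (nhdsWithin 0 {0}ᶜ) (nhds c)) :
    ∃ d > 0, ∀ k ∈ Icc (-π) π, k ≠ 0 → d * |k| ^ β ≤ l k := by
  have h1 := hlasymp.eventually_const_le (half_lt_self hc)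
  rw [eventually_nhdsWithin_iff, Metric.eventually_nhds_iff] at h1
  obtain ⟨ε, hε, h1⟩ := h1
  have hK : IsCompact (Icc (-π) π ∩ {k | ε ≤ |k|}) :=
    isCompact_Icc.inter_right (isClosed_le continuous_const continuous_abs)
  have hne : ∀ k ∈ Icc (-π) π ∩ {k | ε ≤ |k|}, 0 < |k| := fun k hk => hε.trans_le hk.2
  have hcont : ContinuousOn (fun k => l k / |k| ^ β) (Icc (-π) π ∩ {k | ε ≤ |k|}) := by
    apply (hl.mono inter_subset_left).div
    · exact (continuous_abs.rpow_const (fun _ => Or.inr (by linarith))).continuousOn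
    · intro k hk
      have := hne k hk
      positivity
  have h2 : ∃ d > 0, ∀ k ∈ Icc (-π) π ∩ {k | ε ≤ |k|}, d ≤ l k / |k| ^ β := by
    rcases (Icc (-π) π ∩ {k | ε ≤ |k|}).eq_empty_or_nonempty with he | he
    · exact ⟨1, one_pos, by simp [he]⟩
    · obtain ⟨k0, hk0, hm⟩ := hK.exists_isMinOn he hcont
      have h0 := hne k0 hk0
      have := hlpos k0 hk0.1 (abs_pos.1 h0)
      exact ⟨_, by positivity, fun k hk => hm hk⟩
  obtain ⟨d, hd, h2⟩ := h2
  refine ⟨min d (c / 2), lt_min hd (by positivity), fun k hk hk0 => ?_⟩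
  have hk' : 0 < |k| := abs_pos.2 hk0
  rw [← le_div_iff₀ (by positivity)]
  rcases lt_or_ge |k| ε with h | h
  · exact (min_le_right _ _).trans (h1 (by simpa using h) hk0)
  · exact (min_le_left _ _).trans (h2 k ⟨hk, h⟩)

lemma scaled_limit {α β c : ℝ} (hα : 0 < α) (hα1 : α ≤ 1) (hβ1 : 1 < β) (hc : 0 < c)
    (l : ℝ → ℝ) (hl : ContinuousOn l (Icc (-π) π))
    (hlpos : ∀ k ∈ Icc (-π) π, k ≠ 0 → 0 < l k)
    (hlasymp : Tendsto (fun k : ℝ => l k / |k| ^ β) (nhdsWithin 0 {0}ᶜ) (nhds c)) (m : ℤ) :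
    Tendsto (fun T : ℝ => (T : ℂ) * ∫ k in (-π)..π, Complex.exp (-Complex.I * k * m) *
          ((mittagLeffler α (-(T ^ β) * l k) : ℝ) : ℂ)) atTop
      (nhds (∫ s : ℝ, ((mittagLeffler α (-(c * |s| ^ β)) : ℝ) : ℂ))) := by
  obtain ⟨d, hd, hlow⟩ := l_lower hβ1 hc l hl hlpos hlasymp
  have hg : 0 < Real.Gamma (α + 1) := Real.Gamma_pos_of_pos (by positivity)
  have hml := ml_continuous hα hα1
  set h : ℝ → ℝ → ℂ := fun T k => Complex.exp (-Complex.I * k * m) *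
          ((mittagLeffler α (-(T ^ β) * l k) : ℝ) : ℂ) with hh
  have key : Tendsto (fun T : ℝ => ∫ s : ℝ, (Ioc (-π * T) (π * T)).indicator
      (fun s => h T (s / T)) s) atTop
      (nhds (∫ s : ℝ, ((mittagLeffler α (-(c * |s| ^ β)) : ℝ) : ℂ))) := by
    refine tendsto_integral_filter_of_dominated_convergence
      (fun s => (1 + d * (1 / Real.Gamma (α + 1)) * |s| ^ β)⁻¹) ?_ ?_
      (integrable_bound hβ1 (by positivity)) ?_
    · filter_upwards [eventually_gt_atTop 0] with T hT
      rw [aestronglyMeasurable_indicator_iff measurableSet_Ioc]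
      apply ContinuousOn.aestronglyMeasurable _ measurableSet_Ioc
      have hl' : ContinuousOn (fun s => l (s / T)) (Ioc (-π * T) (π * T)) := by
        apply hl.comp (by fun_prop)
        intro s hs
        exact ⟨(le_div_iff₀ hT).2 hs.1.le, (div_le_iff₀ hT).2 hs.2⟩
      have h2 : ContinuousOn (fun s => mittagLeffler α (-(T ^ β) * l (s / T)))
          (Ioc (-π * T) (π * T)) := hml.comp_continuousOn (continuousOn_const.mul hl')
      apply ContinuousOn.mul
      · exact Continuous.continuousOn (by fun_prop)
      · exact Complex.continuous_ofReal.comp_continuousOn h2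
    · filter_upwards [eventually_gt_atTop 0] with T hT
      filter_upwards [Measure.ae_ne volume (0:ℝ)] with s hs0
      have hs' : 0 < |s| := abs_pos.2 hs0
      by_cases hs : s ∈ Ioc (-π * T) (π * T)
      · rw [indicator_of_mem hs]
        have hn : ‖Complex.exp (-Complex.I * (s / T : ℝ) * m)‖ = 1 := by
          rw [Complex.norm_exp]
          simp
        rw [hh]
        simp only
        rw [norm_mul, hn, one_mul, Complex.norm_real, Real.norm_eq_abs, neg_mul]
        have hle := hlow (s / T) ⟨(le_div_iff₀ hT).2 hs.1.le, (div_le_iff₀ hT).2 hs.2⟩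
          (div_ne_zero hs0 hT.ne')
        have := ml_norm_le hα hα1 (y := d * |s| ^ β) (x := T ^ β * l (s / T)) (by positivity) (by
          calc d * |s| ^ β = T ^ β * (d * |s / T| ^ β) := by
                rw [abs_div, abs_of_pos hT, Real.div_rpow hs'.le hT.le]
                field_simp
            _ ≤ _ := by gcongr)
        refine this.trans_eq ?_
        congr 2; ring
      · rw [indicator_of_notMem hs, norm_zero]
        positivity
    · filter_upwards [Measure.ae_ne volume (0:ℝ)] with s hs0
      have hs' : 0 < |s| := abs_pos.2 hs0
      have hT0 : Tendsto (fun T : ℝ => s / T) atTop (nhds 0) := tendsto_const_nhds.div_atTop tendsto_id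
      have hT1 : Tendsto (fun T : ℝ => s / T) atTop (nhdsWithin 0 {0}ᶜ) := by
        refine tendsto_nhdsWithin_iff.2 ⟨hT0, ?_⟩
        filter_upwards [eventually_gt_atTop 0] with T hT
        exact div_ne_zero hs0 hT.ne'
      have h1 : Tendsto (fun T : ℝ => -(T ^ β) * l (s / T)) atTop (nhds (-(c * |s| ^ β))) := by
        have := ((hlasymp.comp hT1).mul_const (|s| ^ β)).neg
        refine this.congr' ?_
        filter_upwards [eventually_gt_atTop 0] with T hT
        simp only [Function.comp]
        rw [abs_div, abs_of_pos hT, Real.div_rpow hs'.le hT.le]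
        field_simp
      have h2 : Tendsto (fun T : ℝ => h T (s / T)) atTop
          (nhds (Complex.exp (-Complex.I * (0:ℝ) * m) *
            ((mittagLeffler α (-(c * |s| ^ β)) : ℝ) : ℂ))) := by
        apply Tendsto.mul
        · have : Continuous fun k : ℝ => Complex.exp (-Complex.I * k * m) := by fun_prop
          exact (this.tendsto 0).comp hT0
        · exact (Complex.continuous_ofReal.tendsto _).comp ((hml.tendsto _).comp h1)
      simp only [Complex.ofReal_zero, mul_zero, zero_mul, Complex.exp_zero, one_mul] at h2
      refine h2.congr' ?_
      filter_upwards [eventually_gt_atTop 0, eventually_gt_atTop (|s| / π)] with T hT hT2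
      rw [div_lt_iff₀' Real.pi_pos, abs_lt] at hT2
      rw [indicator_of_mem]
      exact ⟨by linarith, hT2.2.le⟩
  refine key.congr' ?_
  filter_upwards [eventually_gt_atTop 0] with T hT
  rw [integral_indicator measurableSet_Ioc, ← intervalIntegral.integral_of_le (by
    have := Real.pi_pos; nlinarith), intervalIntegral.integral_comp_div _ hT.ne',
    mul_div_cancel_right₀ _ hT.ne', mul_div_cancel_right₀ _ hT.ne']
  rw [Complex.real_smul]

lemma ml_subst {α β c : ℝ} (hα : 0 < α) (hα1 : α ≤ 1) (hβ1 : 1 < β) (hc : 0 < c) :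
    ∫ s : ℝ, mittagLeffler α (-(c * |s| ^ β)) = 2 / β * c ^ (-(1 : ℝ) / β) *
        ∫ u in Ioi (0:ℝ), u ^ ((1 - β) / β) * mittagLeffler α (-u) := by
  have hβ0 : 0 < β := by linarith
  rw [integral_comp_abs (f := fun s => mittagLeffler α (-(c * s ^ β)))]
  have h1 : ∫ s in Ioi (0:ℝ), mittagLeffler α (-(c * s ^ β)) =
      c ^ (-(1:ℝ) / β) * ∫ s in Ioi (0:ℝ), mittagLeffler α (-(s ^ β)) := by
    have := integral_comp_mul_left_Ioi (fun s => mittagLeffler α (-(s ^ β))) 0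
      (b := c ^ (1 / β)) (by positivity)
    rw [mul_zero, smul_eq_mul, ← Real.rpow_neg hc.le, ← neg_div] at this
    rw [← this]
    apply setIntegral_congr_fun measurableSet_Ioi
    intro s hs
    simp only
    rw [Real.mul_rpow (by positivity) (le_of_lt hs), ← Real.rpow_mul hc.le,
      one_div_mul_cancel hβ0.ne', Real.rpow_one]
  have h2 := integral_comp_rpow_Ioi_of_pos (g := fun s => mittagLeffler α (-(s ^ β))) (p := 1 / β)
    (by positivity)
  rw [h1, ← h2]
  have h3 : ∫ x in Ioi (0:ℝ), (1 / β * x ^ (1 / β - 1)) • mittagLeffler α (-((x ^ (1 / β)) ^ β)) =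
      1 / β * ∫ u in Ioi (0:ℝ), u ^ ((1 - β) / β) * mittagLeffler α (-u) := by
    rw [← integral_const_mul]
    apply setIntegral_congr_fun measurableSet_Ioi
    intro s hs
    simp only
    rw [← Real.rpow_mul (le_of_lt hs), one_div_mul_cancel hβ0.ne', Real.rpow_one, smul_eq_mul,
      sub_div, div_self hβ0.ne', mul_assoc]
  rw [h3]
  ring

lemma ml_int {α β : ℝ} (hα : 0 < α) (hα1 : α ≤ 1) (hβ1 : 1 < β) :
    IntegrableOn (fun u : ℝ => u ^ ((1 - β) / β) * mittagLeffler α (-u)) (Ioi 0) := by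
  have hβ0 : 0 < β := by linarith
  have h := (ml_integrable hα hα1 hβ1 one_pos).integrableOn (s := Ioi 0)
  have h2 := (integrableOn_Ioi_comp_rpow_iff' _ (p := 1 / β) (by positivity)).2 h
  refine h2.congr_fun ?_ measurableSet_Ioi
  intro s hs
  have hs : 0 < s := hs
  simp only
  rw [abs_of_nonneg (by positivity), one_mul, ← Real.rpow_mul hs.le,
    one_div_mul_cancel hβ0.ne', Real.rpow_one, smul_eq_mul, sub_div, div_self hβ0.ne']

theorem GDE_asymptotic_decay
    (α β c : ℝ) (hα : 0 < α) (hα1 : α ≤ 1) (hβ1 : 1 < β) (hβ2 : β ≤ 2) (hc : 0 < c)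
    (l : ℝ → ℝ) (hl : ContinuousOn l (Icc (-π) π))
    (hlpos : ∀ k ∈ Icc (-π) π, k ≠ 0 → 0 < l k)
    (hlasymp : Tendsto (fun k : ℝ => l k / |k| ^ β) (nhdsWithin 0 {0}ᶜ) (nhds c)) :
    IntegrableOn (fun u : ℝ => u ^ ((1 - β) / β) * mittagLeffler α (-u)) (Ioi 0) ∧
    ∀ m : ℤ, Tendsto
      (fun t : ℝ => ((t ^ (α / β) : ℝ) : ℂ) * ((1 / (2 * (π : ℂ))) *
        ∫ k in (-π)..π, Complex.exp (-Complex.I * k * m) *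
          ((mittagLeffler α (-(t ^ α) * l k) : ℝ) : ℂ)))
      atTop
      (nhds (((1 / (π * β) * c ^ (-(1 : ℝ) / β) *
        ∫ u in Ioi (0:ℝ), u ^ ((1 - β) / β) * mittagLeffler α (-u) : ℝ) : ℂ))) := by
  refine ⟨ml_int hα hα1 hβ1, fun m => ?_⟩
  have hβ0 : 0 < β := by linarith
  have hT : Tendsto (fun t : ℝ => t ^ (α / β)) atTop atTop := tendsto_rpow_atTop (by positivity)
  have h := ((scaled_limit hα hα1 hβ1 hc l hl hlpos hlasymp m).comp hT).const_mul
    (1 / (2 * (π : ℂ)))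
  rw [integral_complex_ofReal, ml_subst hα hα1 hβ1 hc] at h
  have e : (((1 / (π * β) * c ^ (-(1 : ℝ) / β) *
        ∫ u in Ioi (0:ℝ), u ^ ((1 - β) / β) * mittagLeffler α (-u) : ℝ) : ℂ)) =
      1 / (2 * (π : ℂ)) * ((2 / β * c ^ (-(1 : ℝ) / β) *
        ∫ u in Ioi (0:ℝ), u ^ ((1 - β) / β) * mittagLeffler α (-u) : ℝ) : ℂ) := by
    have hpi : (π : ℂ) ≠ 0 := by exact_mod_cast Real.pi_ne_zero
    have hb : (β : ℂ) ≠ 0 := by exact_mod_cast hβ0.ne'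
    push_cast
    field_simp
  rw [e]
  refine h.congr' ?_
  filter_upwards [eventually_gt_atTop 0] with t ht
  have : (t ^ (α / β)) ^ β = t ^ α := by
    rw [← Real.rpow_mul ht.le, div_mul_cancel₀ _ hβ0.ne']
  simp only [Function.comp, this]
  ring
end
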